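/- Let (u_p)_{p>1} be a family of nodal solutions of (𝒫_p) satisfying condition (A) and the Morse index one hypothesis (M), and set V_p(x) := |u_p(ε_p x + x_p⁺)/u_p(x_p⁺)|^{p−1}. Then there exist r > 0 and p̄ > 1 such that for all p ≥ p̄: (i) there exists φ ∈ C_c^∞(B(0,r)) with ∫ |∇φ|² dx < ∫ V_p·φ² dx (the rescaled linearized operator has negative first Dirichlet eigenvalue in B(0,r)); and (ii) for every nonzero ψ ∈ C_c^∞(Ω̃⁺(ε_p) ∖ closure(B(0,r))), where Ω̃⁺(ε_p) := ({x ∈ Ω : u_p(x) > 0} − x_p⁺)/ε_p, one has ∫ |∇ψ|² dx > ∫ V_p·ψ² dx (positive first Dirichlet eigenvalue outside B(0,r)). -/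

import Mathlib

open MeasureTheory Real Set Filter Topology Metric

noncomputable section

/-- The Euclidean plane. -/
abbrev R2 : Type := EuclideanSpace ℝ (Fin 2)

/-- The Laplacian: sum of the two pure second directional derivatives. -/
def lap (u : R2 → ℝ) (x : R2) : ℝ :=
  ∑ i : Fin 2,
    fderiv ℝ (fun y => fderiv ℝ u y (EuclideanSpace.single i 1)) x (EuclideanSpace.single i 1)

/-- Each point of ∂Ω has a neighborhood in which ∂Ω is the graph of a C^∞ function
(in suitable Euclidean coordinates). -/
def SmoothBoundary (Ω : Set R2) : Prop :=
  ∀ x ∈ frontier Ω, ∃ V : Set R2, IsOpen V ∧ x ∈ V ∧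
    ∃ (e : R2 ≃ᵢ R2) (g : ℝ → ℝ), ContDiff ℝ (⊤ : ℕ∞) g ∧
      frontier Ω ∩ V = {y | y ∈ V ∧ e y 1 = g (e y 0)}

/-- A (classical) solution of the Lane–Emden problem `(𝒫_p)` on Ω. -/
def IsSolution (Ω : Set R2) (p : ℝ) (u : R2 → ℝ) : Prop :=
  ContDiffOn ℝ 2 u Ω ∧ ContDiffOn ℝ 1 u (closure Ω) ∧
  (∀ x ∈ Ω, -lap u x = |u x| ^ (p - 1) * u x) ∧
  (∀ x ∈ frontier Ω, u x = 0)

/-- A nodal (sign-changing) function on Ω. -/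
def IsNodal (Ω : Set R2) (u : R2 → ℝ) : Prop :=
  (∃ x ∈ Ω, 0 < u x) ∧ ∃ x ∈ Ω, u x < 0

/-- The energy functional E_p. -/
def energy (Ω : Set R2) (p : ℝ) (u : R2 → ℝ) : ℝ :=
  (1 / 2) * ∫ x in Ω, ‖gradient u x‖ ^ 2 - (1 / (p + 1)) * ∫ x in Ω, |u x| ^ (p + 1)

/-- Condition (A): p·∫_Ω |∇u_p|² → 16πe. -/
def CondA (Ω : Set R2) (u : ℝ → R2 → ℝ) : Prop :=
  Tendsto (fun p : ℝ => p * ∫ x in Ω, ‖gradient (u p) x‖ ^ 2) atTop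
    (𝓝 (16 * π * Real.exp 1))

/-- Condition (B): p·(u_p(x_p⁺) + u_p(x_p⁻)) → K for some K ≥ 0. -/
def CondB (u : ℝ → R2 → ℝ) (xp xm : ℝ → R2) : Prop :=
  ∃ K : ℝ, 0 ≤ K ∧ Tendsto (fun p : ℝ => p * (u p (xp p) + u p (xm p))) atTop (𝓝 K)

/-- ε_p := (p·u_p(x_p⁺)^{p−1})^{−1/2}. -/
def eps (u : ℝ → R2 → ℝ) (xp : ℝ → R2) (p : ℝ) : ℝ :=
  1 / Real.sqrt (p * u p (xp p) ^ (p - 1))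

/-- The rescaling z_p of u_p around x_p⁺. -/
def zp (u : ℝ → R2 → ℝ) (xp : ℝ → R2) (p : ℝ) (x : R2) : ℝ :=
  (p / u p (xp p)) * (u p (eps u xp p • x + xp p) - u p (xp p))

/-- The rescaling z_p⁻ of u_p around x_p⁻ (with the scale ε_p of the maximum). -/
def zm (u : ℝ → R2 → ℝ) (xp xm : ℝ → R2) (p : ℝ) (x : R2) : ℝ :=
  (p / u p (xp p)) * (-u p (eps u xp p • x + xm p) - u p (xp p))

/-- Convergence in C²_loc(ℝ²) of a family of functions f_i defined on sets D_i:
every compact set K is eventually contained in D_i, and on K all derivatives up to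
order 2 converge uniformly. -/
def TendstoC2loc {ι : Type} (l : Filter ι) (D : ι → Set R2) (f : ι → R2 → ℝ)
    (g : R2 → ℝ) : Prop :=
  ∀ K : Set R2, IsCompact K →
    (∀ᶠ i in l, K ⊆ D i) ∧
    ∀ n : ℕ, n ≤ 2 →
      TendstoUniformlyOn (fun i x => iteratedFDeriv ℝ n (f i) x)
        (fun x => iteratedFDeriv ℝ n g x) l K

/-- The standard bubble U(x) = −2 log(1 + |x|²/8). -/
def stdBubble (x : R2) : ℝ := -2 * Real.log (1 + ‖x‖ ^ 2 / 8)

/-- The bubble U_μ(x) = log(μ/(1 + μ|x|²/8)²). -/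
def bubble (μ : ℝ) (x : R2) : ℝ := Real.log (μ / (1 + μ * ‖x‖ ^ 2 / 8) ^ 2)

/-- A C^∞ function compactly supported in S. -/
def CcSmoothIn (S : Set R2) (v : R2 → ℝ) : Prop :=
  ContDiff ℝ (⊤ : ℕ∞) v ∧ HasCompactSupport v ∧ tsupport v ⊆ S

/-- The quadratic form of the linearized operator at u. -/
def Qform (p : ℝ) (u v : R2 → ℝ) : ℝ :=
  ∫ x, (‖gradient v x‖ ^ 2 - p * |u x| ^ (p - 1) * v x ^ 2)

/-- Morse index one hypothesis (M): for p large, the quadratic form of the linearized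
operator is negative somewhere on C_c^∞ of the positive nodal domain, but is not
negative definite on any 2-dimensional subspace. -/
def MorseOne (Ω : Set R2) (u : ℝ → R2 → ℝ) : Prop :=
  ∀ᶠ p : ℝ in atTop,
    (∃ v : R2 → ℝ, CcSmoothIn {x ∈ Ω | 0 < u p x} v ∧ Qform p (u p) v < 0) ∧
    ¬ ∃ v w : R2 → ℝ, CcSmoothIn {x ∈ Ω | 0 < u p x} v ∧
        CcSmoothIn {x ∈ Ω | 0 < u p x} w ∧
        LinearIndependent ℝ ![v, w] ∧
        ∀ a b : ℝ, ¬(a = 0 ∧ b = 0) →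
          Qform p (u p) (fun x => a * v x + b * w x) < 0

/-- The partial derivative in the `i`-th coordinate direction. -/
def pd (i : Fin 2) (f : R2 → ℝ) (x : R2) : ℝ :=
  fderiv ℝ f x (EuclideanSpace.single i 1)

theorem lap_eq (f : R2 → ℝ) (x : R2) : lap f x = ∑ i : Fin 2, pd i (pd i f) x := rfl

theorem fderiv_apply_eq_sum_pd (f : R2 → ℝ) (x v : R2) :
    fderiv ℝ f x v = ∑ i : Fin 2, v i * pd i f x := by
  have hv : v = ∑ i : Fin 2, v i • EuclideanSpace.single i (1 : ℝ) := by
    ext j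
    fin_cases j <;> simp
  conv_lhs => rw [hv]
  simp [pd]

theorem norm_gradient_sq (f : R2 → ℝ) (x : R2) :
    ‖gradient f x‖ ^ 2 = ∑ i : Fin 2, pd i f x ^ 2 := by
  rw [EuclideanSpace.norm_sq_eq]
  refine Finset.sum_congr rfl fun i _ => ?_
  have h : gradient f x i = pd i f x := by
    have h1 : inner ℝ (gradient f x) (EuclideanSpace.single i (1 : ℝ)) = pd i f x := by
      simp [gradient, pd]
    rw [← h1, EuclideanSpace.inner_single_right]
    simp
  rw [h, Real.norm_eq_abs, sq_abs]

theorem contDiff_pd {n m : WithTop ℕ∞} {f : R2 → ℝ} (hf : ContDiff ℝ n f) (hm : m + 1 ≤ n)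
    (i : Fin 2) : ContDiff ℝ m (pd i f) :=
  (hf.fderiv_right hm).clm_apply contDiff_const

theorem continuous_pd {f : R2 → ℝ} (hf : ContDiff ℝ 1 f) (i : Fin 2) : Continuous (pd i f) :=
  (contDiff_pd (m := 0) hf (by norm_num) i).continuous

theorem continuous_lap {f : R2 → ℝ} (hf : ContDiff ℝ 2 f) : Continuous (lap f) := by
  have : lap f = fun x => ∑ i : Fin 2, pd i (pd i f) x := rfl
  rw [this]
  exact continuous_finsetSum _ fun i _ =>
    continuous_pd (contDiff_pd hf (by norm_num [one_add_one_eq_two]) i) i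

theorem tsupport_pd_subset (f : R2 → ℝ) (i : Fin 2) : tsupport (pd i f) ⊆ tsupport f := by
  refine closure_minimal ?_ (isClosed_tsupport f)
  intro x hx
  by_contra h
  apply hx
  have : fderiv ℝ f x = 0 := by
    have := support_fderiv_subset ℝ (f := f)
    by_contra h0
    exact h (this h0)
  simp [pd, this]

theorem hasCompactSupport_pd {f : R2 → ℝ} (hf : HasCompactSupport f) (i : Fin 2) :
    HasCompactSupport (pd i f) :=
  hf.of_isClosed_subset (isClosed_tsupport _) (tsupport_pd_subset f i)

theorem pd_congr {f g : R2 → ℝ} {x : R2} (h : f =ᶠ[𝓝 x] g) (i : Fin 2) : pd i f x = pd i g x := by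
  simp [pd, h.fderiv_eq]

theorem pd_eventuallyEq {f g : R2 → ℝ} {x : R2} (h : f =ᶠ[𝓝 x] g) (i : Fin 2) :
    pd i f =ᶠ[𝓝 x] pd i g := by
  filter_upwards [h.eventuallyEq_nhds] with y hy using pd_congr hy i

theorem lap_congr {f g : R2 → ℝ} {x : R2} (h : f =ᶠ[𝓝 x] g) : lap f x = lap g x := by
  simp only [lap_eq]
  exact Finset.sum_congr rfl fun i _ => pd_congr (pd_eventuallyEq h i) i

theorem pd_mul {f g : R2 → ℝ} {x : R2} (hf : DifferentiableAt ℝ f x) (hg : DifferentiableAt ℝ g x)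
    (i : Fin 2) : pd i (fun y => f y * g y) x = f x * pd i g x + pd i f x * g x := by
  simp only [pd]
  rw [fderiv_fun_mul hf hg]
  simp [mul_comm]

theorem pd_add {f g : R2 → ℝ} {x : R2} (hf : DifferentiableAt ℝ f x) (hg : DifferentiableAt ℝ g x)
    (i : Fin 2) : pd i (fun y => f y + g y) x = pd i f x + pd i g x := by
  simp only [pd]
  rw [fderiv_fun_add hf hg]
  simp

theorem pd_neg (f : R2 → ℝ) (x : R2) (i : Fin 2) : pd i (fun y => - f y) x = - pd i f x := by
  simp [pd, fderiv_fun_neg]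

theorem pd_const_mul {f : R2 → ℝ} {x : R2} (hf : DifferentiableAt ℝ f x) (c : ℝ)
    (i : Fin 2) : pd i (fun y => c * f y) x = c * pd i f x := by
  simp only [pd]
  rw [fderiv_const_mul hf]
  simp

theorem pd_const_add (f : R2 → ℝ) (x : R2) (c : ℝ) (i : Fin 2) :
    pd i (fun y => c + f y) x = pd i f x := by
  simp [pd, fderiv_const_add]

theorem pd_comp {f : R2 → ℝ} {F : ℝ → ℝ} {F' : ℝ} {x : R2} (hf : DifferentiableAt ℝ f x)
    (hF : HasDerivAt F F' (f x)) (i : Fin 2) :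
    pd i (fun y => F (f y)) x = F' * pd i f x := by
  simp only [pd]
  have := hF.comp_hasFDerivAt x hf.hasFDerivAt
  have h2 : fderiv ℝ (fun y => F (f y)) x = F' • fderiv ℝ f x := this.fderiv
  rw [h2]; simp

theorem pd_comp_affine (f : R2 → ℝ) (a : ℝ) (b x : R2) (i : Fin 2) :
    pd i (fun y => f (b + a • y)) x = a * pd i f (b + a • x) := by
  simp only [pd]
  have h1 : (fun y => f (b + a • y)) = fun y => (fun z => f (b + z)) (a • y) := rfl
  rw [h1, fderiv_comp_smul (f := fun z => f (b + z)) a, fderiv_comp_add_left]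
  simp

theorem lap_comp_affine {f : R2 → ℝ} {a : ℝ} {b x : R2}
    (hf : ContDiffAt ℝ 2 f (b + a • x)) :
    lap (fun y => f (b + a • y)) x = a ^ 2 * lap f (b + a • x) := by
  simp only [lap_eq, Finset.mul_sum]
  refine Finset.sum_congr rfl fun i _ => ?_
  have h1 : pd i (fun y => f (b + a • y)) = fun y => a * pd i f (b + a • y) :=
    funext fun y => pd_comp_affine f a b y i
  have hd : DifferentiableAt ℝ (pd i f) (b + a • x) := by
    have : ContDiffAt ℝ 1 (fderiv ℝ f) (b + a • x) := hf.fderiv_right (by norm_num [one_add_one_eq_two])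
    exact (this.clm_apply contDiffAt_const).differentiableAt (by norm_num)
  have hd2 : DifferentiableAt ℝ (fun y => pd i f (b + a • y)) x :=
    DifferentiableAt.comp x (f := fun y => b + a • y) hd (by fun_prop)
  rw [h1, pd_const_mul hd2, pd_comp_affine]
  ring

theorem contDiffAt_pd {f : R2 → ℝ} {x : R2} (hf : ContDiffAt ℝ 2 f x) (i : Fin 2) :
    ContDiffAt ℝ 1 (pd i f) x :=
  (hf.fderiv_right (by norm_num [one_add_one_eq_two])).clm_apply contDiffAt_const

theorem lap_const_mul {f : R2 → ℝ} {x : R2} (hf : ContDiffAt ℝ 2 f x) (c : ℝ) :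
    lap (fun y => c * f y) x = c * lap f x := by
  simp only [lap_eq, Finset.mul_sum]
  refine Finset.sum_congr rfl fun i _ => ?_
  have h1 : pd i (fun y => c * f y) =ᶠ[𝓝 x] fun y => c * pd i f y := by
    filter_upwards [hf.eventually (by simp)] with y hy
    exact pd_const_mul (hy.differentiableAt (by norm_num)) c i
  rw [pd_congr h1, pd_const_mul ((contDiffAt_pd hf i).differentiableAt (by norm_num))]

theorem lap_neg (f : R2 → ℝ) (x : R2) : lap (fun y => - f y) x = - lap f x := by
  simp only [lap_eq, ← Finset.sum_neg_distrib]
  refine Finset.sum_congr rfl fun i _ => ?_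
  have h1 : pd i (fun y => - f y) = fun y => - pd i f y := funext fun y => pd_neg f y i
  rw [h1, pd_neg]

theorem lap_const_add (f : R2 → ℝ) (x : R2) (c : ℝ) : lap (fun y => c + f y) x = lap f x := by
  simp only [lap_eq]
  refine Finset.sum_congr rfl fun i _ => ?_
  have h1 : pd i (fun y => c + f y) = pd i f := funext fun y => pd_const_add f y c i
  rw [h1]

theorem lap_comp {f : R2 → ℝ} {F F' : ℝ → ℝ} {F'' : ℝ} {x : R2} (hf : ContDiffAt ℝ 2 f x)
    (hF : ∀ t, HasDerivAt F (F' t) t) (hF' : HasDerivAt F' F'' (f x)) :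
    lap (fun y => F (f y)) x = F' (f x) * lap f x + F'' * ∑ i : Fin 2, pd i f x ^ 2 := by
  simp only [lap_eq, Finset.mul_sum, ← Finset.sum_add_distrib]
  refine Finset.sum_congr rfl fun i _ => ?_
  have h1 : pd i (fun y => F (f y)) =ᶠ[𝓝 x] fun y => F' (f y) * pd i f y := by
    filter_upwards [hf.eventually (by simp)] with y hy
    exact pd_comp (hy.differentiableAt (by norm_num)) (hF _) i
  have hfx := hf.differentiableAt (by norm_num)
  rw [pd_congr h1, pd_mul (f := fun y => F' (f y)) (hF'.differentiableAt.comp x hfx)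
    ((contDiffAt_pd hf i).differentiableAt (by norm_num)), pd_comp hfx hF']
  ring

theorem integral_mul_pd {f g : R2 → ℝ} (hf : ContDiff ℝ 1 f) (hg : ContDiff ℝ 1 g)
    (hgc : HasCompactSupport g) (i : Fin 2) :
    ∫ x, f x * pd i g x = - ∫ x, pd i f x * g x := by
  have hf0 := hf.continuous
  have hg0 := hg.continuous
  refine integral_mul_fderiv_eq_neg_fderiv_mul_of_integrable
    (f := f) (g := g) (v := EuclideanSpace.single i 1) ?_ ?_ ?_
    (fun x _ => hf.differentiable (by norm_num) x) (fun x _ => hg.differentiable (by norm_num) x)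
  · exact ((continuous_pd hf i).mul hg0).integrable_of_hasCompactSupport hgc.mul_left
  · exact (hf0.mul (continuous_pd hg i)).integrable_of_hasCompactSupport
      (hasCompactSupport_pd hgc i).mul_left
  · exact (hf0.mul hg0).integrable_of_hasCompactSupport hgc.mul_left

theorem integral_lap_mul {f g : R2 → ℝ} (hf : ContDiff ℝ 2 f) (hg : ContDiff ℝ 1 g)
    (hgc : HasCompactSupport g) :
    ∫ x, lap f x * g x = - ∫ x, ∑ i : Fin 2, pd i f x * pd i g x := by
  have hfi : ∀ i, ContDiff ℝ 1 (pd i f) := fun i =>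
    contDiff_pd hf (by norm_num [one_add_one_eq_two]) i
  simp only [lap_eq, Finset.sum_mul]
  rw [integral_finsetSum, integral_finsetSum, ← Finset.sum_neg_distrib]
  · refine Finset.sum_congr rfl fun i _ => ?_
    rw [integral_mul_pd (hfi i) hg hgc i, neg_neg]
  · intro i _
    exact ((hfi i).continuous.mul (continuous_pd hg i)).integrable_of_hasCompactSupport
      (hasCompactSupport_pd hgc i).mul_left
  · intro i _
    exact ((continuous_pd (hfi i) i).mul hg.continuous).integrable_of_hasCompactSupport
      hgc.mul_left

theorem hasDerivAt_posPart_pow (n : ℕ) (t : ℝ) :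
    HasDerivAt (fun s : ℝ => max s 0 ^ (n + 2)) ((n + 2) * max t 0 ^ (n + 1)) t := by
  rcases lt_trichotomy t 0 with h | h | h
  · rw [max_eq_right h.le]
    refine ((hasDerivAt_const t (0 : ℝ)).congr_of_eventuallyEq ?_).congr_deriv (by simp)
    filter_upwards [eventually_lt_nhds h] with s hs
    simp [max_eq_right hs.le]
  · subst h
    have he : (fun s : ℝ => max s 0 ^ (n + 2)) = fun s => max s 0 ^ (n + 1) * s := by
      funext s
      rcases le_total s 0 with hs | hs
      · simp [max_eq_right hs]
      · simp [max_eq_left hs, pow_succ]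
    rw [he, hasDerivAt_iff_tendsto_slope]
    have hc : Tendsto (fun s : ℝ => max s 0 ^ (n + 1)) (𝓝[≠] 0) (𝓝 0) := by
      have : Continuous fun s : ℝ => max s 0 ^ (n + 1) := by fun_prop
      have h0 := this.tendsto 0
      simp only [max_self, ne_eq, Nat.add_eq_zero_iff, one_ne_zero, and_false, not_false_eq_true,
        zero_pow] at h0
      exact h0.mono_left nhdsWithin_le_nhds
    simp only [max_self, ne_eq, Nat.add_eq_zero_iff, one_ne_zero, and_false, not_false_eq_true,
      zero_pow, mul_zero]
    refine hc.congr' ?_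
    filter_upwards [self_mem_nhdsWithin] with s hs
    have hs' : s ≠ 0 := hs
    simp [slope_def_field, hs']
  · rw [max_eq_left h.le]
    have := hasDerivAt_pow (n + 2) t
    refine (this.congr_of_eventuallyEq ?_).congr_deriv (by push_cast; simp)
    filter_upwards [eventually_gt_nhds h] with s hs
    simp [max_eq_left hs.le]

theorem contDiff_posPart_pow (n : ℕ) : ContDiff ℝ n fun s : ℝ => max s 0 ^ (n + 1) := by
  induction n with
  | zero =>
    simp only [CharP.cast_eq_zero, contDiff_zero]
    fun_prop
  | succ n ih =>
    push_cast
    rw [contDiff_succ_iff_deriv]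
    refine ⟨fun t => (hasDerivAt_posPart_pow n t).differentiableAt, by simp, ?_⟩
    have : deriv (fun s : ℝ => max s 0 ^ (n + 1 + 1)) = fun t : ℝ => ((n : ℝ) + 2) * max t 0 ^ (n + 1) :=
      funext fun t => (hasDerivAt_posPart_pow n t).deriv
    rw [this]
    exact contDiff_const.mul ih

/-- The averaging kernel `(1 - |y|²)₊`. -/
def avKer (y : R2) : ℝ := max (1 - ‖y‖ ^ 2) 0

/-- The potential `(1 - |y|²)₊² / 4` of the averaging kernel. -/
def kerPot (y : R2) : ℝ := max (1 - ‖y‖ ^ 2) 0 ^ 2 / 4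

theorem avKer_nonneg (y : R2) : 0 ≤ avKer y := le_max_right _ _

theorem kerPot_nonneg (y : R2) : 0 ≤ kerPot y := by unfold kerPot; positivity

theorem avKer_le_one (y : R2) : avKer y ≤ 1 :=
  max_le (by nlinarith [sq_nonneg ‖y‖]) zero_le_one

theorem avKer_eq_zero {y : R2} (hy : 1 ≤ ‖y‖) : avKer y = 0 :=
  max_eq_right (by nlinarith)

theorem kerPot_eq_zero {y : R2} (hy : 1 ≤ ‖y‖) : kerPot y = 0 := by
  have : max (1 - ‖y‖ ^ 2) 0 = 0 := avKer_eq_zero hy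
  simp [kerPot, this]

theorem avKer_ge {y : R2} (hy : ‖y‖ ≤ 1 / 2) : 3 / 4 ≤ avKer y :=
  le_max_of_le_left (by nlinarith [norm_nonneg y])

theorem kerPot_le (y : R2) : kerPot y ≤ avKer y := by
  have h0 := avKer_nonneg y
  have h1 := avKer_le_one y
  have : kerPot y = avKer y ^ 2 / 4 := rfl
  nlinarith

theorem continuous_avKer : Continuous avKer := by unfold avKer; fun_prop

theorem contDiff_kerPot : ContDiff ℝ 1 kerPot := by
  have h := contDiff_posPart_pow 1
  have h2 : ContDiff ℝ 1 fun y : R2 => 1 - ‖y‖ ^ 2 := contDiff_const.sub (contDiff_norm_sq ℝ)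
  exact (h.comp h2).div_const 4

theorem hasCompactSupport_of_norm_ge {f : R2 → ℝ} {r : ℝ} (h : ∀ y, r ≤ ‖y‖ → f y = 0) :
    HasCompactSupport f := by
  refine HasCompactSupport.of_support_subset_isCompact (isCompact_closedBall (0 : R2) r) ?_
  intro y hy
  by_contra hc
  apply hy
  apply h
  simp only [mem_closedBall, dist_zero_right, not_le] at hc
  exact hc.le

theorem hasCompactSupport_avKer : HasCompactSupport avKer :=
  hasCompactSupport_of_norm_ge fun _ hy => avKer_eq_zero hy

theorem hasCompactSupport_kerPot : HasCompactSupport kerPot :=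
  hasCompactSupport_of_norm_ge fun _ hy => kerPot_eq_zero hy

theorem integrable_avKer : Integrable avKer :=
  continuous_avKer.integrable_of_hasCompactSupport hasCompactSupport_avKer

theorem integrable_kerPot : Integrable kerPot :=
  contDiff_kerPot.continuous.integrable_of_hasCompactSupport hasCompactSupport_kerPot

theorem pd_kerPot (y : R2) (i : Fin 2) : pd i kerPot y = - (avKer y * y i) := by
  have h1 : HasDerivAt (fun s : ℝ => max s 0 ^ 2 / 4) (max (1 - ‖y‖ ^ 2) 0 / 2) (1 - ‖y‖ ^ 2) := by
    refine ((hasDerivAt_posPart_pow 0 (1 - ‖y‖ ^ 2)).div_const 4).congr_deriv ?_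
    push_cast; ring
  have h2 : DifferentiableAt ℝ (fun y : R2 => 1 - ‖y‖ ^ 2) y :=
    ((contDiff_const.sub (contDiff_norm_sq ℝ)).differentiable (n := 1) (by norm_num)) y
  have h3 := pd_comp h2 h1 i
  have h4 : pd i (fun y : R2 => 1 - ‖y‖ ^ 2) y = - (2 * y i) := by
    simp only [pd]
    rw [fderiv_const_sub]
    simp [fderiv_norm_sq_apply, EuclideanSpace.inner_single_right]
  rw [h4] at h3
  change pd i (fun y : R2 => max (1 - ‖y‖ ^ 2) 0 ^ 2 / 4) y = _
  rw [h3]; unfold avKer; ring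

/-- The mass of the averaging kernel. -/
def kerMass : ℝ := ∫ y, avKer y

theorem kerMass_pos : 0 < kerMass := by
  refine (integral_pos_iff_support_of_nonneg avKer_nonneg integrable_avKer).2 ?_
  exact (continuous_avKer.isOpen_support).measure_pos _ ⟨0, by simp [avKer]⟩

theorem integral_kerPot_le : ∫ y, kerPot y ≤ kerMass :=
  integral_mono integrable_kerPot integrable_avKer kerPot_le

theorem hasDerivAt_average {G : R2 → ℝ} (hG : ContDiff ℝ 2 G) (hGc : HasCompactSupport G)
    (x0 : R2) (t : ℝ) :
    HasDerivAt (fun s : ℝ => ∫ y, G (x0 + s • y) * avKer y)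
      (t * ∫ y, lap G (x0 + t • y) * kerPot y) t := by
  have hG1 : ContDiff ℝ 1 G := hG.of_le (by norm_num)
  obtain ⟨C, hC⟩ := (hG1.continuous_fderiv (by norm_num)).bounded_above_of_compact_support
    (hGc.fderiv ℝ)
  have hcont : Continuous (fderiv ℝ G) := hG1.continuous_fderiv (by norm_num)
  have key := hasDerivAt_integral_of_dominated_loc_of_deriv_le (μ := (volume : Measure R2))
    (F := fun (s : ℝ) y => G (x0 + s • y) * avKer y)
    (F' := fun (s : ℝ) y => fderiv ℝ G (x0 + s • y) y * avKer y) (x₀ := t) (s := univ)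
    (bound := fun y => C * avKer y) univ_mem
    (Eventually.of_forall fun s => by
      have := hG.continuous; have := continuous_avKer
      exact Continuous.aestronglyMeasurable (by fun_prop))
    (by
      have := hG.continuous; have := continuous_avKer
      exact Continuous.integrable_of_hasCompactSupport (by fun_prop) hasCompactSupport_avKer.mul_left)
    (((hcont.comp (by fun_prop : Continuous fun y : R2 => x0 + t • y)).clm_apply
      continuous_id).mul continuous_avKer).aestronglyMeasurable
    (Eventually.of_forall fun y s _ => by
      rw [norm_mul, Real.norm_of_nonneg (avKer_nonneg y)]
      rcases le_or_gt 1 ‖y‖ with h | h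
      · simp [avKer_eq_zero h]
      · refine mul_le_mul_of_nonneg_right ?_ (avKer_nonneg y)
        calc ‖fderiv ℝ G (x0 + s • y) y‖ ≤ ‖fderiv ℝ G (x0 + s • y)‖ * ‖y‖ :=
              ContinuousLinearMap.le_opNorm _ _
          _ ≤ C * 1 := mul_le_mul (hC _) h.le (norm_nonneg _) ((norm_nonneg _).trans (hC 0))
          _ = C := mul_one C)
    (integrable_avKer.const_mul C)
    (Eventually.of_forall fun y s _ => by
      have h1 : HasDerivAt (fun s : ℝ => x0 + s • y) y s := by
        simpa using ((hasDerivAt_id s).smul_const y).const_add x0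
      have h2 := (hG1.differentiable (by norm_num) (x0 + s • y)).hasFDerivAt.comp_hasDerivAt s h1
      exact h2.mul_const (avKer y))
  refine key.2.congr_deriv ?_
  have hfi : ∀ i, ContDiff ℝ 1 (pd i G) := fun i =>
    contDiff_pd hG (by norm_num [one_add_one_eq_two]) i
  have hci : ∀ i, ContDiff ℝ 1 fun y => pd i G (x0 + t • y) := fun i =>
    (hfi i).comp (by fun_prop)
  have e1 : ∀ y, fderiv ℝ G (x0 + t • y) y * avKer y
      = - ∑ i : Fin 2, pd i G (x0 + t • y) * pd i kerPot y := by
    intro y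
    rw [fderiv_apply_eq_sum_pd, Finset.sum_mul, ← Finset.sum_neg_distrib]
    refine Finset.sum_congr rfl fun i _ => ?_
    rw [pd_kerPot]; ring
  simp_rw [e1]
  rw [integral_neg, integral_finsetSum]
  · have e2 : ∀ i : Fin 2, ∫ y, pd i G (x0 + t • y) * pd i kerPot y
        = - (t * ∫ y, pd i (pd i G) (x0 + t • y) * kerPot y) := by
      intro i
      rw [integral_mul_pd (hci i) contDiff_kerPot hasCompactSupport_kerPot i,
        ← integral_const_mul]
      congr 1
      refine integral_congr_ae (Eventually.of_forall fun y => ?_)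
      simp only [pd_comp_affine]
      ring
    simp_rw [e2]
    rw [Finset.sum_neg_distrib, neg_neg, ← Finset.mul_sum, ← integral_finsetSum]
    · simp only [lap_eq, Finset.sum_mul]
    · intro i _
      have h1 := continuous_pd (hfi i) i
      have h2 := contDiff_kerPot.continuous
      exact Continuous.integrable_of_hasCompactSupport (by fun_prop)
        hasCompactSupport_kerPot.mul_left
  · intro i _
    have h1 := (hci i).continuous
    have h2 := continuous_pd contDiff_kerPot i
    exact Continuous.integrable_of_hasCompactSupport (by fun_prop)
      (hasCompactSupport_pd hasCompactSupport_kerPot i).mul_left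

/-- Mean value inequality: if `ΔG ≤ C` in the ball of radius `ρ`, the weighted average of `G`
exceeds the central value by at most a multiple of `Cρ²`. -/
theorem average_le {G : R2 → ℝ} (hG : ContDiff ℝ 2 G) (hGc : HasCompactSupport G)
    {x0 : R2} {ρ C : ℝ} (hρ : 0 ≤ ρ) (hC : 0 ≤ C) (hlap : ∀ x ∈ ball x0 ρ, lap G x ≤ C) :
    ∫ y, G (x0 + ρ • y) * avKer y ≤ (G x0 + C * ρ ^ 2) * kerMass := by
  set A : ℝ → ℝ := fun s => ∫ y, G (x0 + s • y) * avKer y with hA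
  set B : ℝ → ℝ := fun s => C * s ^ 2 / 2 * (∫ y, kerPot y) - A s with hB
  have hJ0 : 0 ≤ ∫ y, kerPot y := integral_nonneg kerPot_nonneg
  have hd : ∀ t, HasDerivAt B (C * t * (∫ y, kerPot y) -
      t * ∫ y, lap G (x0 + t • y) * kerPot y) t := by
    intro t
    have h1 : HasDerivAt (fun s : ℝ => C * s ^ 2 / 2 * (∫ y, kerPot y))
        (C * t * (∫ y, kerPot y)) t := by
      refine ((((hasDerivAt_pow 2 t).const_mul C).div_const 2).mul_const _).congr_deriv ?_
      push_cast; ring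
    exact h1.sub (hasDerivAt_average hG hGc x0 t)
  have hmono : MonotoneOn B (Icc 0 ρ) := by
    refine monotoneOn_of_deriv_nonneg (convex_Icc 0 ρ)
      (fun t _ => (hd t).continuousAt.continuousWithinAt)
      (fun t _ => (hd t).differentiableAt.differentiableWithinAt) ?_
    intro t ht
    rw [interior_Icc] at ht
    rw [(hd t).deriv]
    have h2 : ∫ y, lap G (x0 + t • y) * kerPot y ≤ C * ∫ y, kerPot y := by
      rw [← integral_const_mul]
      have hl := continuous_lap hG
      have hk := contDiff_kerPot.continuous
      refine integral_mono (Continuous.integrable_of_hasCompactSupport (by fun_prop)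
        hasCompactSupport_kerPot.mul_left) (integrable_kerPot.const_mul C) ?_
      intro y
      rcases le_or_gt 1 ‖y‖ with h | h
      · simp [kerPot_eq_zero h]
      · refine mul_le_mul_of_nonneg_right (hlap _ ?_) (kerPot_nonneg y)
        simp only [mem_ball, dist_self_add_left, norm_smul, Real.norm_of_nonneg ht.1.le]
        nlinarith [ht.1, ht.2, norm_nonneg y]
    nlinarith [ht.1]
  have h := hmono (left_mem_Icc.2 hρ) (right_mem_Icc.2 hρ) hρ
  have hA0 : A 0 = G x0 * kerMass := by
    simp [hA, kerMass, integral_const_mul]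
  have hJ := integral_kerPot_le
  simp only [hB, hA0] at h
  have : C * ρ ^ 2 / 2 * ∫ y, kerPot y ≤ C * ρ ^ 2 * kerMass := by
    have : 0 ≤ C * ρ ^ 2 := by positivity
    nlinarith
  change A ρ ≤ _
  nlinarith

theorem integral_comp_affine (f : R2 → ℝ) (x0 : R2) {ρ : ℝ} (hρ : 0 < ρ) :
    ∫ y, f (x0 + ρ • y) = (ρ ^ 2)⁻¹ * ∫ z, f z := by
  have h := Measure.integral_comp_smul (volume : Measure R2) (fun y => f (x0 + y)) ρ
  rw [h, integral_add_left_eq_self (μ := volume) f x0]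
  simp [abs_of_pos hρ]

theorem integral_kernel_le {G : R2 → ℝ} (hG : ContDiff ℝ 2 G) (hGc : HasCompactSupport G)
    {x0 : R2} {ρ C : ℝ} (hρ : 0 < ρ) (hC : 0 ≤ C) (hlap : ∀ x ∈ ball x0 ρ, lap G x ≤ C) :
    ∫ z, G z * avKer (ρ⁻¹ • (z - x0)) ≤ ρ ^ 2 * ((G x0 + C * ρ ^ 2) * kerMass) := by
  have h := average_le hG hGc hρ.le hC hlap
  have h2 := integral_comp_affine (fun z => G z * avKer (ρ⁻¹ • (z - x0))) x0 hρ
  simp only [add_sub_cancel_left, smul_smul, inv_mul_cancel₀ hρ.ne', one_smul] at h2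
  rw [h2, inv_mul_eq_div, div_le_iff₀ (by positivity)] at h
  linarith

theorem contDiff_mul_of_tsupport_subset {n : WithTop ℕ∞} {χ W : R2 → ℝ} {U : Set R2} (hU : IsOpen U)
    (hχ : ContDiff ℝ n χ) (hs : tsupport χ ⊆ U) (hW : ContDiffOn ℝ n W U) :
    ContDiff ℝ n fun x => χ x * W x := by
  rw [contDiff_iff_contDiffAt]
  intro x
  by_cases hx : x ∈ U
  · exact hχ.contDiffAt.mul (hW.contDiffAt (hU.mem_nhds hx))
  · have h0 : (fun x => χ x * W x) =ᶠ[𝓝 x] fun _ => 0 := by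
      have hx' : x ∈ (tsupport χ)ᶜ := fun h => hx (hs h)
      filter_upwards [(isClosed_tsupport χ).isOpen_compl.mem_nhds hx'] with y hy
      rw [image_eq_zero_of_notMem_tsupport hy, zero_mul]
    exact contDiffAt_const.congr_of_eventuallyEq h0

/-- A nonnegative function with bounded Laplacian that vanishes at the centre of a ball is
bounded in a smaller ball. -/
theorem le_of_lap_bounded {W : R2 → ℝ} {U : Set R2} {C : ℝ} (hU : IsOpen U)
    (hsub : closedBall (0 : R2) 3 ⊆ U) (hW : ContDiffOn ℝ 2 W U) (hpos : ∀ x ∈ U, 0 ≤ W x)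
    (h0 : W 0 = 0) (hlap : ∀ x ∈ U, |lap W x| ≤ C) {x : R2} (hx : x ∈ closedBall (0 : R2) (1 / 2)) :
    W x ≤ 86 * C := by
  let χ : ContDiffBump (0 : R2) := ⟨2, 3, by norm_num, by norm_num⟩
  have hχs : tsupport χ = closedBall (0 : R2) 3 := χ.tsupport_eq
  set G : R2 → ℝ := fun x => χ x * W x with hGdef
  have hC : 0 ≤ C := (abs_nonneg _).trans (hlap 0 (hsub (by simp)))
  have hG : ContDiff ℝ 2 G :=
    contDiff_mul_of_tsupport_subset hU χ.contDiff (hχs ▸ hsub) hW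
  have hGc : HasCompactSupport G := χ.hasCompactSupport.mul_right
  have hGnn : ∀ z, 0 ≤ G z := by
    intro z
    by_cases hz : z ∈ U
    · exact mul_nonneg χ.nonneg (hpos z hz)
    · have : χ z = 0 := image_eq_zero_of_notMem_tsupport fun h => hz (hsub (hχs ▸ h))
      simp [hGdef, this]
  have hGW : ∀ z ∈ ball (0 : R2) 2, G =ᶠ[𝓝 z] W := by
    intro z hz
    filter_upwards [isOpen_ball.mem_nhds hz] with y hy
    have : χ y = 1 := χ.one_of_mem_closedBall (ball_subset_closedBall hy)
    simp [hGdef, this]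
  have hlapG : ∀ z ∈ ball (0 : R2) 2, |lap G z| ≤ C := by
    intro z hz
    rw [lap_congr (hGW z hz)]
    exact hlap z (hsub (closedBall_subset_closedBall (by norm_num) (ball_subset_closedBall hz)))
  have hx' : ‖x‖ ≤ 1 / 2 := by simpa using hx
  have hG0 : G 0 = 0 := by simp [hGdef, h0]
  have hGx : G x = W x := (hGW x (by simp; linarith)).eq_of_nhds
  have h1 := integral_kernel_le hG hGc (x0 := 0) (ρ := 2) (by norm_num) hC
    fun z hz => (le_abs_self _).trans (hlapG z hz)
  have h2 := integral_kernel_le (G := fun z => - G z) hG.neg hGc.neg (x0 := x) (ρ := 1 / 2)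
    (by norm_num) hC fun z hz => by
      rw [lap_neg]
      refine (neg_le_abs _).trans (hlapG z ?_)
      rw [mem_ball] at hz ⊢
      have := dist_triangle z x 0
      rw [dist_zero_right x] at this
      linarith
  have hck := continuous_avKer
  have hcG := hG.continuous
  have h3 : ∫ z, G z * avKer ((1 / 2 : ℝ)⁻¹ • (z - x))
      ≤ ∫ z, 4 / 3 * (G z * avKer ((2 : ℝ)⁻¹ • (z - 0))) := by
    refine integral_mono (Continuous.integrable_of_hasCompactSupport (by fun_prop) hGc.mul_right)
      (Continuous.integrable_of_hasCompactSupport (by fun_prop) hGc.mul_right.mul_left) ?_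
    intro z
    have hk0 := avKer_nonneg ((2 : ℝ)⁻¹ • (z - 0))
    have hle : avKer ((1 / 2 : ℝ)⁻¹ • (z - x)) ≤ 4 / 3 * avKer ((2 : ℝ)⁻¹ • (z - 0)) := by
      rcases le_or_gt 1 ‖(1 / 2 : ℝ)⁻¹ • (z - x)‖ with h | h
      · rw [avKer_eq_zero h]; positivity
      · have h4 : ‖z - x‖ < 1 / 2 := by
          rw [norm_smul] at h; norm_num at h; linarith
        have h5 : ‖z‖ ≤ 1 := by
          have := norm_add_le (z - x) x
          rw [sub_add_cancel] at this
          linarith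
        have h6 : 3 / 4 ≤ avKer ((2 : ℝ)⁻¹ • (z - 0)) := avKer_ge (by
          rw [sub_zero, norm_smul]; norm_num; linarith)
        linarith [avKer_le_one ((1 / 2 : ℝ)⁻¹ • (z - x))]
    calc G z * avKer ((1 / 2 : ℝ)⁻¹ • (z - x)) ≤ G z * (4 / 3 * avKer ((2 : ℝ)⁻¹ • (z - 0))) :=
          mul_le_mul_of_nonneg_left hle (hGnn z)
      _ = _ := by ring
  rw [integral_const_mul] at h3
  simp only [neg_mul, integral_neg] at h2
  rw [hG0] at h1
  rw [hGx] at h2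
  have hI := kerMass_pos
  have h7 : W x * kerMass ≤ (86 * C) * kerMass := by nlinarith
  exact le_of_mul_le_mul_right h7 hI

theorem integral_avKer_scaled (x0 : R2) {ρ : ℝ} (hρ : 0 < ρ) :
    ∫ z, avKer (ρ⁻¹ • (z - x0)) = ρ ^ 2 * kerMass := by
  have h2 := integral_comp_affine (fun z => avKer (ρ⁻¹ • (z - x0))) x0 hρ
  simp only [add_sub_cancel_left, smul_smul, inv_mul_cancel₀ hρ.ne', one_smul] at h2
  rw [kerMass, h2, mul_inv_cancel_left₀ (by positivity)]

theorem integrable_avKer_scaled (x0 : R2) {ρ : ℝ} (hρ : 0 < ρ) :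
    Integrable fun z => avKer (ρ⁻¹ • (z - x0)) :=
  (integrable_avKer.comp_smul (inv_ne_zero hρ.ne')).comp_sub_right x0

/-- A function with `ΔG ≥ -δ` that attains its maximal value `1` at `x0` is close to `1` on
average. -/
theorem integral_one_sub_le {G : R2 → ℝ} (hG : ContDiff ℝ 2 G) (hGc : HasCompactSupport G)
    {x0 : R2} {ρ δ : ℝ} (hρ : 0 < ρ) (hδ : 0 ≤ δ) (hlap : ∀ x, -δ ≤ lap G x) (h1 : G x0 = 1) :
    ∫ z, (1 - G z) * avKer (ρ⁻¹ • (z - x0)) ≤ δ * ρ ^ 4 * kerMass := by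
  have h2 := integral_kernel_le (G := fun z => - G z) hG.neg hGc.neg (x0 := x0) hρ hδ
    fun z _ => by rw [lap_neg]; linarith [hlap z]
  have hck := continuous_avKer
  have hcG := hG.continuous
  have h3 : ∀ z, (1 - G z) * avKer (ρ⁻¹ • (z - x0)) =
      avKer (ρ⁻¹ • (z - x0)) + -G z * avKer (ρ⁻¹ • (z - x0)) := fun z => by ring
  simp_rw [h3]
  have h4 : Integrable fun z => -G z * avKer (ρ⁻¹ • (z - x0)) :=
    Continuous.integrable_of_hasCompactSupport (by fun_prop) hGc.neg.mul_right
  rw [integral_add (integrable_avKer_scaled x0 hρ) h4, integral_avKer_scaled x0 hρ]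
  rw [h1] at h2
  nlinarith

/-- The point of the plane with polar coordinates `(s, θ)`. -/
def polarPt (s θ : ℝ) : R2 := !₂[s * cos θ, s * sin θ]

theorem continuous_polarPt : Continuous fun q : ℝ × ℝ => polarPt q.1 q.2 := by
  unfold polarPt
  refine (PiLp.continuous_toLp 2 _).comp (continuous_pi fun i => ?_)
  fin_cases i <;> simp <;> fun_prop

theorem norm_polarPt {s : ℝ} (hs : 0 ≤ s) (θ : ℝ) : ‖polarPt s θ‖ = s := by
  rw [EuclideanSpace.norm_eq, Fin.sum_univ_two]
  simp only [polarPt, PiLp.toLp_apply, Matrix.cons_val_zero, Matrix.cons_val_one, norm_mul,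
    Real.norm_eq_abs, mul_pow, sq_abs]
  rw [← mul_add, cos_sq_add_sin_sq, mul_one, sqrt_sq hs]

theorem exists_polarPt (z : R2) : ∃ θ ∈ Icc (-π) π, z = polarPt ‖z‖ θ := by
  set c : ℂ := ⟨z 0, z 1⟩ with hc
  have hn : ‖c‖ = ‖z‖ := by
    rw [EuclideanSpace.norm_eq, Fin.sum_univ_two, Complex.norm_def, Complex.normSq_apply]
    simp [hc, pow_two]
  refine ⟨c.arg, ⟨(Complex.neg_pi_lt_arg c).le, Complex.arg_le_pi c⟩, ?_⟩
  ext i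
  fin_cases i
  · simp [polarPt, ← hn, Complex.norm_mul_cos_arg]
    rfl
  · simp [polarPt, ← hn, Complex.norm_mul_sin_arg]
    rfl

theorem integral_annulus {f : R2 → ℝ} (hf : Continuous f) :
    ∫ z in {z : R2 | ‖z‖ ∈ Ioo (1 : ℝ) 2}, f z =
      ∫ s in (1 : ℝ)..2, ∫ θ in (-π)..π, s * f (polarPt s θ) := by
  have hmeas : MeasurableSet {z : R2 | ‖z‖ ∈ Ioo (1 : ℝ) 2} :=
    (isOpen_Ioo.preimage continuous_norm).measurableSet
  set g : R2 → ℝ := indicator {z : R2 | ‖z‖ ∈ Ioo (1 : ℝ) 2} f with hg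
  have h1 : ∫ z, g z = ∫ c : ℂ, g (Complex.orthonormalBasisOneI.repr c) :=
    ((Complex.orthonormalBasisOneI.measurePreserving_repr).integral_comp
      Complex.orthonormalBasisOneI.repr.toHomeomorph.measurableEmbedding g).symm
  have h2 : ∀ p : ℝ × ℝ, Complex.orthonormalBasisOneI.repr (Complex.polarCoord.symm p)
      = polarPt p.1 p.2 := by
    intro p
    ext i
    fin_cases i <;> simp [polarPt, Complex.orthonormalBasisOneI, Complex.polarCoord_symm_apply,
      Complex.cos_ofReal_im, Complex.sin_ofReal_im, Complex.cos_ofReal_re, Complex.sin_ofReal_re]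
  have h3 : ∫ p in polarCoord.target, p.1 • g (polarPt p.1 p.2)
      = ∫ p in Ioo (1 : ℝ) 2 ×ˢ Ioo (-π) π, p.1 * f (polarPt p.1 p.2) := by
    rw [← integral_indicator (polarCoord.open_target.measurableSet),
      ← integral_indicator (measurableSet_Ioo.prod measurableSet_Ioo)]
    congr 1
    funext p
    simp only [indicator, polarCoord_target, mem_prod, mem_Ioi, hg, mem_ofPred_eq, smul_eq_mul]
    by_cases hp : 0 < p.1
    · simp only [norm_polarPt hp.le]
      by_cases h4 : p.1 ∈ Ioo (1 : ℝ) 2 <;> by_cases h5 : p.2 ∈ Ioo (-π) π <;> simp [hp, h4, h5]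
    · have : p.1 ∉ Ioo (1 : ℝ) 2 := fun h => hp (by linarith [h.1])
      simp [hp, this]
  rw [← integral_indicator hmeas, h1, ← Complex.integral_comp_polarCoord_symm]
  simp_rw [h2]
  rw [h3, Measure.volume_eq_prod, setIntegral_prod]
  · rw [intervalIntegral.integral_of_le (by norm_num), integral_Ioc_eq_integral_Ioo]
    refine setIntegral_congr_fun measurableSet_Ioo fun s _ => ?_
    simp only
    rw [intervalIntegral.integral_of_le (by linarith [pi_pos]), integral_Ioc_eq_integral_Ioo]
  · have hc : Continuous fun p : ℝ × ℝ => p.1 * f (polarPt p.1 p.2) :=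
      continuous_fst.mul (hf.comp continuous_polarPt)
    exact (hc.continuousOn.integrableOn_compact (isCompact_Icc.prod isCompact_Icc)).mono_set
      (prod_mono Ioo_subset_Icc_self Ioo_subset_Icc_self)

theorem hasDerivAt_polarPt (s θ : ℝ) :
    HasDerivAt (fun t => polarPt s t) (!₂[-(s * sin θ), s * cos θ] : R2) θ := by
  have h : HasDerivAt (fun t => (![s * cos t, s * sin t] : Fin 2 → ℝ))
      (![-(s * sin θ), s * cos θ]) θ := by
    rw [hasDerivAt_pi]
    intro i
    fin_cases i
    · simpa using (hasDerivAt_cos θ).const_mul s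
    · simpa using (hasDerivAt_sin θ).const_mul s
  exact ((PiLp.continuousLinearEquiv 2 ℝ (fun _ : Fin 2 => ℝ)).symm.toContinuousLinearMap.hasFDerivAt).comp_hasDerivAt
    θ h

theorem le_integral_circle {G : R2 → ℝ} (hG : ContDiff ℝ 1 G) {s : ℝ} (hs : 0 ≤ s)
    (hz : ∃ z : R2, ‖z‖ = s ∧ G z = 0) {θ : ℝ} (hθ : θ ∈ Icc (-π) π) :
    G (polarPt s θ) ≤ ∫ t in (-π)..π, s * ‖fderiv ℝ G (polarPt s t)‖ := by
  obtain ⟨z, hzs, hGz⟩ := hz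
  obtain ⟨θ₀, hθ₀, hzθ⟩ := exists_polarPt z
  rw [hzs] at hzθ
  have hcf : Continuous (fderiv ℝ G) := hG.continuous_fderiv (by norm_num)
  have hcp : Continuous fun t => polarPt s t := continuous_polarPt.comp (by fun_prop : Continuous fun t : ℝ => (s, t))
  have hv : Continuous fun t : ℝ => (!₂[-(s * sin t), s * cos t] : R2) := by
    refine (PiLp.continuous_toLp 2 _).comp (continuous_pi fun i => ?_)
    fin_cases i <;> simp <;> fun_prop
  set H' : ℝ → ℝ := fun t => fderiv ℝ G (polarPt s t) (!₂[-(s * sin t), s * cos t] : R2) with hH'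
  have hd : ∀ t, HasDerivAt (fun t => G (polarPt s t)) (H' t) t := fun t =>
    (hG.differentiable (by norm_num) _).hasFDerivAt.comp_hasDerivAt t (hasDerivAt_polarPt s t)
  have hcH : Continuous H' := (hcf.comp hcp).clm_apply hv
  have hbound : ∀ t, |H' t| ≤ s * ‖fderiv ℝ G (polarPt s t)‖ := by
    intro t
    have h1 : ‖(!₂[-(s * sin t), s * cos t] : R2)‖ = s := by
      rw [EuclideanSpace.norm_eq, Fin.sum_univ_two]
      simp only [Matrix.cons_val_zero, Matrix.cons_val_one, norm_mul, norm_neg,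
        Real.norm_eq_abs, mul_pow, sq_abs]
      rw [← mul_add, sin_sq_add_cos_sq, mul_one, sqrt_sq hs]
    have h2 := (fderiv ℝ G (polarPt s t)).le_opNorm (!₂[-(s * sin t), s * cos t] : R2)
    rw [h1] at h2
    rw [mul_comm]
    exact h2
  have hcN : Continuous fun t => s * ‖fderiv ℝ G (polarPt s t)‖ :=
    continuous_const.mul (hcf.comp hcp).norm
  have hInt : G (polarPt s θ) = ∫ t in θ₀..θ, H' t := by
    rw [intervalIntegral.integral_eq_sub_of_hasDerivAt (fun t _ => hd t)
      (hcH.intervalIntegrable _ _), ← hzθ, hGz, sub_zero]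
  have h3 : |∫ t in θ₀..θ, (|H' t|)| ≤ |∫ t in (-π)..π, (|H' t|)| := by
    refine intervalIntegral.abs_integral_mono_interval ?_
      (Eventually.of_forall fun t => abs_nonneg _) (hcH.abs.intervalIntegrable _ _)
    rw [uIoc_of_le (by linarith [pi_pos] : -π ≤ π)]
    refine Ioc_subset_Ioc (le_min hθ₀.1 hθ.1) (max_le hθ₀.2 hθ.2)
  have hpi : -π ≤ π := by linarith [pi_pos]
  calc G (polarPt s θ) ≤ |∫ t in θ₀..θ, H' t| := hInt ▸ le_abs_self _
    _ ≤ |∫ t in θ₀..θ, (|H' t|)| := by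
        simpa only [Real.norm_eq_abs] using
          intervalIntegral.norm_integral_le_abs_integral_norm (f := H') (a := θ₀) (b := θ) (μ := volume)
    _ ≤ |∫ t in (-π)..π, (|H' t|)| := h3
    _ = ∫ t in (-π)..π, |H' t| := abs_of_nonneg
        (intervalIntegral.integral_nonneg hpi fun t _ => abs_nonneg _)
    _ ≤ _ := intervalIntegral.integral_mono_on hpi (hcH.abs.intervalIntegrable _ _)
        (hcN.intervalIntegrable _ _) fun t _ => hbound t

theorem integral_annulus_le {G : R2 → ℝ} (hG : ContDiff ℝ 1 G)
    (hz : ∀ s ∈ Icc (1 : ℝ) 2, ∃ z : R2, ‖z‖ = s ∧ G z = 0) :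
    ∫ z in {z : R2 | ‖z‖ ∈ Ioo (1 : ℝ) 2}, G z ≤
      4 * π * ∫ z in {z : R2 | ‖z‖ ∈ Ioo (1 : ℝ) 2}, ‖fderiv ℝ G z‖ := by
  have hcf : Continuous fun z => ‖fderiv ℝ G z‖ := (hG.continuous_fderiv (by norm_num)).norm
  rw [integral_annulus hG.continuous, integral_annulus hcf, ← intervalIntegral.integral_const_mul]
  have hcont : ∀ {f : R2 → ℝ}, Continuous f →
      Continuous fun s : ℝ => ∫ θ in (-π)..π, s * f (polarPt s θ) := fun {f} hf =>
    intervalIntegral.continuous_parametric_intervalIntegral_of_continuous' (f := fun s θ => s * f (polarPt s θ))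
      (continuous_fst.mul (hf.comp continuous_polarPt)) _ _
  refine intervalIntegral.integral_mono_on (by norm_num)
    ((hcont hG.continuous).intervalIntegrable _ _)
    (((hcont hcf).const_mul _).intervalIntegrable _ _) fun s hs => ?_
  have hs0 : 0 ≤ s := by linarith [hs.1]
  set N := ∫ t in (-π)..π, s * ‖fderiv ℝ G (polarPt s t)‖ with hN
  have hpi : -π ≤ π := by linarith [pi_pos]
  have hN0 : 0 ≤ N := intervalIntegral.integral_nonneg hpi fun t _ => by positivity
  have hcp : Continuous fun t => polarPt s t := continuous_polarPt.comp (by fun_prop : Continuous fun t : ℝ => (s, t))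
  calc ∫ θ in (-π)..π, s * G (polarPt s θ) ≤ ∫ θ in (-π)..π, s * N :=
        intervalIntegral.integral_mono_on hpi
          ((continuous_const.mul (hG.continuous.comp hcp)).intervalIntegrable _ _)
          (continuous_const.intervalIntegrable _ _)
          fun θ hθ => mul_le_mul_of_nonneg_left (le_integral_circle hG hs0 (hz s hs) hθ) hs0
    _ = 2 * π * s * N := by rw [intervalIntegral.integral_const]; simp; ring
    _ ≤ 4 * π * N := by
        refine mul_le_mul_of_nonneg_right ?_ hN0
        nlinarith [hs.2, pi_pos]

theorem norm_fderiv_sq (f : R2 → ℝ) (x : R2) : ‖fderiv ℝ f x‖ ^ 2 = ∑ i : Fin 2, pd i f x ^ 2 := by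
  rw [← norm_gradient_sq, gradient, LinearIsometryEquiv.norm_map]

theorem integral_mul_lap {f g : R2 → ℝ} (hf : ContDiff ℝ 1 f) (hg : ContDiff ℝ 2 g)
    (hgc : HasCompactSupport g) :
    ∫ x, f x * lap g x = - ∫ x, ∑ i : Fin 2, pd i f x * pd i g x := by
  have hgi : ∀ i, ContDiff ℝ 1 (pd i g) := fun i =>
    contDiff_pd hg (by norm_num [one_add_one_eq_two]) i
  simp only [lap_eq, Finset.mul_sum]
  rw [integral_finsetSum, integral_finsetSum, ← Finset.sum_neg_distrib]
  · refine Finset.sum_congr rfl fun i _ => ?_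
    rw [integral_mul_pd hf (hgi i) (hasCompactSupport_pd hgc i) i]
  · intro i _
    exact ((continuous_pd hf i).mul (hgi i).continuous).integrable_of_hasCompactSupport
      (hasCompactSupport_pd hgc i).mul_left
  · intro i _
    exact (hf.continuous.mul (continuous_pd (hgi i) i)).integrable_of_hasCompactSupport
      (hasCompactSupport_pd (hasCompactSupport_pd hgc i) i).mul_left

theorem lap_sq {G : R2 → ℝ} (hG : ContDiff ℝ 2 G) (x : R2) :
    lap (fun y => G y ^ 2) x = 2 * G x * lap G x + 2 * ‖fderiv ℝ G x‖ ^ 2 := by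
  rw [norm_fderiv_sq]
  refine lap_comp (F := fun t => t ^ 2) (F' := fun t => 2 * t) hG.contDiffAt (fun t => ?_) ?_
  · simpa using hasDerivAt_pow 2 t
  · simpa using (hasDerivAt_id (G x)).const_mul 2

/-- There is a universal lower bound on the defect of subharmonicity of a function with values in
`[0, 1]` that equals `1` at a point of the unit circle and has a zero on each circle of radius
between `1` and `2`. -/
theorem exists_lower_bound_defect : ∃ δ₀ > (0 : ℝ), ∀ (G : R2 → ℝ) (x0 : R2) (δ : ℝ),
    ContDiff ℝ 2 G → HasCompactSupport G → (∀ x, 0 ≤ G x) → (∀ x, G x ≤ 1) → ‖x0‖ = 1 → G x0 = 1 →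
    0 ≤ δ → (∀ x, -δ ≤ lap G x) → (∀ s ∈ Icc (1 : ℝ) 2, ∃ z : R2, ‖z‖ = s ∧ G z = 0) → δ₀ ≤ δ := by
  let χ : ContDiffBump (0 : R2) := ⟨2, 3, by norm_num, by norm_num⟩
  have hχs : tsupport χ = closedBall (0 : R2) 3 := χ.tsupport_eq
  have hχ : ContDiff ℝ 2 χ := χ.contDiff
  have hχc : HasCompactSupport χ := χ.hasCompactSupport
  have hχlc : HasCompactSupport (lap χ) :=
    hχc.of_isClosed_subset (isClosed_tsupport _) (closure_minimal (fun x hx => by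
      by_contra h
      apply hx
      rw [lap_eq]
      refine Finset.sum_eq_zero fun i _ => image_eq_zero_of_notMem_tsupport fun h2 => h ?_
      exact tsupport_pd_subset _ _ (tsupport_pd_subset _ _ h2)) (isClosed_tsupport _))
  have hlχ := continuous_lap hχ
  obtain ⟨B, hB⟩ := hlχ.bounded_above_of_compact_support hχlc
  have hB0 : 0 ≤ B := (norm_nonneg _).trans (hB 0)
  set A : Set R2 := {z : R2 | ‖z‖ ∈ Ioo (1 : ℝ) 2} with hAdef
  have hAopen : IsOpen A := isOpen_Ioo.preimage continuous_norm
  have hAb : Bornology.IsBounded A := isBounded_ball.subset (s := A) (t := ball (0 : R2) 2)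
    fun z hz => by simpa using hz.2
  set a : ℝ := volume.real A with ha
  have hApos : 0 < a := by
    refine ENNReal.toReal_pos (hAopen.measure_pos _ ?_).ne' hAb.measure_lt_top.ne
    refine ⟨polarPt (3 / 2) 0, ?_⟩
    simp only [hAdef, mem_ofPred_eq]
    rw [norm_polarPt (by norm_num)]
    norm_num
  set m : ℝ := 8 ^ 4 * kerMass with hm
  have hm0 : 0 < m := by have := kerMass_pos; positivity
  set X : ℝ := ∫ x, χ x with hX
  have hX0 : 0 ≤ X := integral_nonneg fun x => χ.nonneg
  set K1 : ℝ := B * (8 / 3) * m + 2 * X with hK1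
  have hK10 : 0 ≤ K1 := by positivity
  set K2 : ℝ := 4 / 3 * m + 16 * π ^ 2 * K1 with hK2
  have hK20 : 0 < K2 := by positivity
  refine ⟨3 / 4 * a / K2, by positivity, ?_⟩
  intro G x0 δ hG hGc hG0 hG1 hx0 hGx0 hδ hlap hz
  have hcG := hG.continuous
  have hck := continuous_avKer
  have hG1' : ContDiff ℝ 1 G := hG.of_le (by norm_num)
  have hcf : Continuous (fderiv ℝ G) := hG1'.continuous_fderiv (by norm_num)
  have hav := integral_one_sub_le hG hGc (x0 := x0) (ρ := 8) (by norm_num) hδ hlap hGx0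
  set w : R2 → ℝ := fun z => avKer ((8 : ℝ)⁻¹ • (z - x0)) with hw
  have hw0 : ∀ z, 0 ≤ w z := fun z => avKer_nonneg _
  have hwge : ∀ z : R2, ‖z‖ ≤ 3 → 3 / 4 ≤ w z := by
    intro z hz
    refine avKer_ge ?_
    rw [norm_smul]
    have := norm_sub_le z x0
    norm_num
    linarith
  have hwi : Integrable fun z => (1 - G z) * w z := by
    have h1 : Integrable w := integrable_avKer_scaled x0 (by norm_num)
    have h2 : Integrable fun z => G z * w z :=
      Continuous.integrable_of_hasCompactSupport (by fun_prop) hGc.mul_right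
    refine (h1.sub h2).congr (Eventually.of_forall fun z => ?_)
    simp only [Pi.sub_apply]
    ring
  have hav' : ∫ z, (1 - G z) * w z ≤ m * δ := by
    refine hav.trans (le_of_eq ?_)
    rw [hm]; ring
  -- the energy estimate
  have hG2 : ContDiff ℝ 2 fun x => G x ^ 2 := hG.pow 2
  have hE : ∫ x, χ x * ‖fderiv ℝ G x‖ ^ 2 ≤ K1 * δ / 2 := by
    have e1 : ∫ x, lap (fun y => G y ^ 2) x * χ x = - ∫ x, (1 - G x ^ 2) * lap χ x := by
      rw [integral_lap_mul hG2 (hχ.of_le (by norm_num)) hχc,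
        integral_mul_lap (contDiff_const.sub (hG2.of_le (by norm_num))) hχ hχc, ← integral_neg,
        ← integral_neg, ← integral_neg]
      refine integral_congr_ae (Eventually.of_forall fun x => ?_)
      simp only [neg_neg]
      rw [← Finset.sum_neg_distrib]
      refine Finset.sum_congr rfl fun i _ => ?_
      have := pd_const_add (fun y => - G y ^ 2) x 1 i
      simp only [← sub_eq_add_neg] at this
      rw [this, pd_neg]
      ring
    have hl2 := continuous_lap hG2
    have hχ0 := hχ.continuous
    have e2 : ∫ x, 2 * (χ x * ‖fderiv ℝ G x‖ ^ 2) ≤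
        ∫ x, (lap (fun y => G y ^ 2) x * χ x + 2 * δ * χ x) := by
      refine integral_mono (Continuous.integrable_of_hasCompactSupport (by fun_prop)
        hχc.mul_right.mul_left) (Continuous.integrable_of_hasCompactSupport (by fun_prop)
        (hχc.mul_left.add hχc.mul_left)) fun x => ?_
      simp only
      rw [lap_sq hG]
      have h1 : -δ ≤ G x * lap G x := by nlinarith [hlap x, hG0 x, hG1 x]
      have h2 : 0 ≤ χ x * (G x * lap G x + δ) := mul_nonneg χ.nonneg (by linarith)
      nlinarith
    have e3 : - ∫ x, (1 - G x ^ 2) * lap χ x ≤ ∫ x, B * (8 / 3) * ((1 - G x) * w x) := by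
      rw [← integral_neg]
      refine integral_mono (Continuous.integrable_of_hasCompactSupport (by fun_prop)
        hχlc.mul_left.neg) (hwi.const_mul _) fun x => ?_
      have h1 : 0 ≤ 1 - G x := by linarith [hG1 x]
      have h2 : 1 - G x ^ 2 ≤ 2 * (1 - G x) := by nlinarith [hG0 x]
      have h20 : 0 ≤ 1 - G x ^ 2 := by nlinarith [hG0 x]
      simp only
      by_cases hx : ‖x‖ ≤ 3
      · have h3 := hwge x hx
        have h4 : - lap χ x ≤ B := (neg_le_abs _).trans (hB x)
        have h5 : (1 - G x) * (3 / 4) ≤ (1 - G x) * w x := mul_le_mul_of_nonneg_left h3 h1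
        calc -((1 - G x ^ 2) * lap χ x) = (1 - G x ^ 2) * - lap χ x := by ring
          _ ≤ (1 - G x ^ 2) * B := mul_le_mul_of_nonneg_left h4 h20
          _ ≤ 2 * (1 - G x) * B := mul_le_mul_of_nonneg_right h2 hB0
          _ = B * (8 / 3) * ((1 - G x) * (3 / 4)) := by ring
          _ ≤ _ := mul_le_mul_of_nonneg_left h5 (by positivity)
      · have h3 : lap χ x = 0 := by
          rw [lap_eq]
          refine Finset.sum_eq_zero fun i _ => image_eq_zero_of_notMem_tsupport fun h2 => hx ?_
          have := tsupport_pd_subset _ _ (tsupport_pd_subset _ _ h2)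
          rw [hχs] at this
          simpa using this
        rw [h3, mul_zero, neg_zero]
        exact mul_nonneg (by positivity) (mul_nonneg h1 (hw0 x))
    have hi1 : Integrable fun x => lap (fun y => G y ^ 2) x * χ x :=
      Continuous.integrable_of_hasCompactSupport (by fun_prop) hχc.mul_left
    have hi2 : Integrable fun x => 2 * δ * χ x :=
      Continuous.integrable_of_hasCompactSupport (by fun_prop) hχc.mul_left
    rw [integral_add hi1 hi2, e1, integral_const_mul, integral_const_mul] at e2
    rw [integral_const_mul] at e3
    have e4 : B * (8 / 3) * ∫ z, (1 - G z) * w z ≤ B * (8 / 3) * (m * δ) :=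
      mul_le_mul_of_nonneg_left hav' (by positivity)
    rw [hK1]
    nlinarith
  -- the area of the annulus
  have hA1 : ∫ z in A, (1 - G z) ≤ 4 / 3 * (m * δ) := by
    calc ∫ z in A, (1 - G z) ≤ ∫ z in A, 4 / 3 * ((1 - G z) * w z) := by
          refine setIntegral_mono_on ?_ (hwi.const_mul _).integrableOn hAopen.measurableSet
            fun z hz => ?_
          · exact (Continuous.continuousOn (by fun_prop)).integrableOn_compact
              (isCompact_closedBall (0 : R2) 2) |>.mono_set fun z hz => by simpa using hz.2.le
          · have h1 : 0 ≤ 1 - G z := by linarith [hG1 z]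
            nlinarith [hwge z (by linarith [hz.2])]
      _ ≤ ∫ z, 4 / 3 * ((1 - G z) * w z) :=
          setIntegral_le_integral (hwi.const_mul _) (Eventually.of_forall fun z =>
            mul_nonneg (by norm_num) (mul_nonneg (by linarith [hG1 z]) (hw0 z)))
      _ ≤ _ := by rw [integral_const_mul]; linarith
  have hA2 : ∫ z in A, G z ≤ 4 * π * ∫ z in A, ‖fderiv ℝ G z‖ := integral_annulus_le hG1' hz
  have hIA : ∀ {f : R2 → ℝ}, Continuous f → IntegrableOn f A := fun {f} hf =>
    hf.continuousOn.integrableOn_compact (isCompact_closedBall (0 : R2) 2) |>.mono_set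
      fun z hz => by simpa using hz.2.le
  have hA3 : ∫ z in A, ‖fderiv ℝ G z‖ ≤ a / (16 * π) + 4 * π * (K1 * δ / 2) := by
    have hχ0 := hχ.continuous
    calc ∫ z in A, ‖fderiv ℝ G z‖ ≤
          ∫ z in A, (1 / (16 * π) + 4 * π * (χ z * ‖fderiv ℝ G z‖ ^ 2)) := by
          refine setIntegral_mono_on (hIA hcf.norm) (hIA (by fun_prop)) hAopen.measurableSet
            fun z hz => ?_
          have h1 : χ z = 1 := χ.one_of_mem_closedBall (by simpa using hz.2.le)
          rw [h1, one_mul]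
          set N := ‖fderiv ℝ G z‖
          have h2 : 0 ≤ (1 - 8 * π * N) ^ 2 / (16 * π) := by positivity
          have h3 : (1 - 8 * π * N) ^ 2 / (16 * π) = 1 / (16 * π) + 4 * π * N ^ 2 - N := by
            field_simp; ring
          linarith
      _ = a / (16 * π) + 4 * π * ∫ z in A, χ z * ‖fderiv ℝ G z‖ ^ 2 := by
          rw [integral_add (hIA continuous_const) (hIA (by fun_prop)), setIntegral_const,
            integral_const_mul, smul_eq_mul]
          ring
      _ ≤ _ := by
          have h1 : ∫ z in A, χ z * ‖fderiv ℝ G z‖ ^ 2 ≤ ∫ z, χ z * ‖fderiv ℝ G z‖ ^ 2 :=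
            setIntegral_le_integral (Continuous.integrable_of_hasCompactSupport (by fun_prop)
              hχc.mul_right) (Eventually.of_forall fun z => mul_nonneg χ.nonneg (sq_nonneg _))
          have := h1.trans hE
          gcongr
  have hA4 : a = (∫ z in A, (1 - G z)) + ∫ z in A, G z := by
    rw [integral_sub (hIA continuous_const) (hIA hcG), setIntegral_const]
    simp [ha]
  have hA5 : 4 * π * ∫ z in A, ‖fderiv ℝ G z‖ ≤ a / 4 + 8 * π ^ 2 * K1 * δ := by
    calc 4 * π * ∫ z in A, ‖fderiv ℝ G z‖ ≤ 4 * π * (a / (16 * π) + 4 * π * (K1 * δ / 2)) :=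
          mul_le_mul_of_nonneg_left hA3 (by positivity)
      _ = _ := by field_simp; ring
  rw [div_le_iff₀ hK20, hK2]
  have h9 : 0 ≤ π ^ 2 * K1 * δ := by positivity
  linarith

theorem exists_frontier_dist_eq_of_graph {Ω V : Set R2} {e : R2 ≃ᵢ R2} {g : ℝ → ℝ}
    (hg : Continuous g) (hV : frontier Ω ∩ V = {y | y ∈ V ∧ e y 1 = g (e y 0)}) {y : R2} {s : ℝ}
    (hy : y ∈ frontier Ω) (hs : 0 ≤ s) (hsV : closedBall y s ⊆ V) :
    ∃ z ∈ frontier Ω, dist z y = s := by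
  have hyV : y ∈ V := hsV (mem_closedBall_self hs)
  have hyg : e y 1 = g (e y 0) := (hV.subset ⟨hy, hyV⟩).2
  set a : ℝ := e y 0 with ha
  set γ : ℝ → R2 := fun t => e.symm !₂[t, g t] with hγ
  have hγc : Continuous γ := by
    refine e.symm.continuous.comp ((PiLp.continuous_toLp 2 _).comp (continuous_pi fun i => ?_))
    fin_cases i <;> simp <;> fun_prop
  have hγa : γ a = y := by
    rw [hγ]
    simp only
    rw [e.symm_apply_eq]
    ext i
    fin_cases i
    · simp [ha]
    · simp [hyg]
  have hlb : ∀ t, t - a ≤ dist (γ t) y := by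
    intro t
    have h1 : dist (γ t) y = dist (!₂[t, g t] : R2) (e y) := by
      rw [← e.dist_eq]; simp [hγ]
    rw [h1, dist_eq_norm]
    have h2 := PiLp.norm_apply_le (!₂[t, g t] - e y : R2) 0
    refine le_trans ?_ h2
    simpa [ha] using le_abs_self (t - e y 0)
  have hivt := intermediate_value_Icc (show a ≤ a + s by linarith)
    (f := fun t => dist (γ t) y) (hγc.dist continuous_const).continuousOn
  have hmem : s ∈ Icc (dist (γ a) y) (dist (γ (a + s)) y) :=
    ⟨by simpa [hγa] using hs, by linarith [hlb (a + s)]⟩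
  obtain ⟨t, -, ht⟩ := hivt hmem
  replace ht : dist (γ t) y = s := ht
  refine ⟨γ t, ?_, ht⟩
  have htV : γ t ∈ V := hsV (mem_closedBall.2 ht.le)
  exact (hV.superset ⟨htV, by simp [hγ]⟩).1

/-- Small circles centred at a boundary point meet the boundary. -/
theorem exists_frontier_dist_eq {Ω : Set R2} (hb : Bornology.IsBounded Ω) (hsm : SmoothBoundary Ω) :
    ∃ s₀ > (0 : ℝ), ∀ y ∈ frontier Ω, ∀ s, 0 ≤ s → s < s₀ → ∃ z ∈ frontier Ω, dist z y = s := by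
  have hc : IsCompact (frontier Ω) := hb.isCompact_closure.of_isClosed_subset isClosed_frontier
    frontier_subset_closure
  choose! V hVo hxV e g hg hV using hsm
  obtain ⟨s₀, hs₀, h⟩ := lebesgue_number_lemma_of_metric hc (c := fun x : frontier Ω => V x)
    (fun x => hVo x x.2) fun x hx => mem_iUnion.2 ⟨⟨x, hx⟩, hxV x hx⟩
  refine ⟨s₀, hs₀, fun y hy s hs hss => ?_⟩
  obtain ⟨x, hx⟩ := h y hy
  exact exists_frontier_dist_eq_of_graph (hg x x.2).continuous (hV x x.2) hy hs
    ((closedBall_subset_ball hss).trans hx)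

/-- A smooth cutoff function that equals `1` on the unit ball can have arbitrarily small Dirichlet
energy. -/
theorem exists_cutoff_small_energy {η : ℝ} (hη : 0 < η) : ∃ r > (1 : ℝ), ∃ φ : R2 → ℝ,
    ContDiff ℝ (⊤ : ℕ∞) φ ∧ HasCompactSupport φ ∧ tsupport φ ⊆ ball (0 : R2) r ∧
    (∀ x ∈ ball (0 : R2) 1, φ x = 1) ∧ ∫ x, ‖gradient φ x‖ ^ 2 < η := by
  let χ : ContDiffBump (0 : R2) := ⟨1, 2, by norm_num, by norm_num⟩
  have hχ : ContDiff ℝ (⊤ : ℕ∞) χ := χ.contDiff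
  have hχ1 : ContDiff ℝ 1 χ := χ.contDiff
  have hχd : Differentiable ℝ χ := hχ1.differentiable (by norm_num)
  have hχc : HasCompactSupport χ := χ.hasCompactSupport
  set E : ℝ := ∫ x, ∑ i : Fin 2, pd i χ x ^ 2 with hE
  obtain ⟨N, hN⟩ := exists_nat_gt (E / η + 1)
  have hE0 : 0 ≤ E := integral_nonneg fun x => Finset.sum_nonneg fun i _ => sq_nonneg _
  have hN1 : (1 : ℝ) < N := lt_of_le_of_lt (by have : 0 ≤ E / η := by positivity
                                               linarith) hN
  have hN0 : (0 : ℝ) < N := by linarith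
  set a : ℕ → ℝ := fun j => (2 ^ j)⁻¹ with ha
  have ha0 : ∀ j, 0 < a j := fun j => by positivity
  set f : ℕ → R2 → ℝ := fun j x => χ (0 + a j • x) with hf
  have hfs : ∀ j, ContDiff ℝ (⊤ : ℕ∞) (f j) := fun j => by
    exact hχ.comp (contDiff_const.add (contDiff_id.const_smul _))
  have hfd : ∀ j, Differentiable ℝ (f j) := fun j => (hfs j).differentiable (by simp)
  have hpf : ∀ i j x, pd i (f j) x = a j * pd i χ (0 + a j • x) := fun i j x =>
    pd_comp_affine _ _ _ _ _
  have hp1 : ∀ i y, ‖y‖ < 1 → pd i χ y = 0 := by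
    intro i y hy
    have h1 : (χ : R2 → ℝ) =ᶠ[𝓝 y] fun _ => 1 := by
      filter_upwards [isOpen_ball.mem_nhds (mem_ball_zero_iff.2 hy)] with z hz
      exact χ.one_of_mem_closedBall (ball_subset_closedBall hz)
    rw [pd_congr h1]
    simp [pd]
  have hp2 : ∀ i y, 2 ≤ ‖y‖ → pd i χ y = 0 := by
    intro i y hy
    have h1 : χ y = 0 := χ.zero_of_le_dist (by simpa using hy)
    have h2 : IsLocalMin χ y := Eventually.of_forall fun z => by
      rw [h1]; exact χ.nonneg
    simp [pd, h2.fderiv_eq_zero]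
  have hdisj : ∀ i x j k, j ≠ k → pd i (f j) x * pd i (f k) x = 0 := by
    intro i x
    have key : ∀ j k, j < k → pd i (f j) x * pd i (f k) x = 0 := by
      intro j k hjk
      rw [hpf, hpf, zero_add, zero_add]
      rcases le_or_gt 2 ‖a j • x‖ with h | h
      · rw [hp2 i _ h]; ring
      · have h3 : ‖a k • x‖ < 1 := by
          rw [norm_smul, norm_of_nonneg (ha0 _).le] at h ⊢
          have h4 : a k ≤ a j / 2 := by
            obtain ⟨d, rfl⟩ := Nat.exists_eq_add_of_lt hjk
            simp only [ha]
            rw [inv_eq_one_div, inv_eq_one_div, div_div, ← pow_succ]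
            exact one_div_le_one_div_of_le (by positivity)
              (pow_le_pow_right₀ (by norm_num) (by omega))
          nlinarith [norm_nonneg x]
        rw [hp1 i _ h3]; ring
    intro j k hjk
    rcases lt_or_gt_of_ne hjk with h | h
    · exact key j k h
    · rw [mul_comm]; exact key k j h
  set φ : R2 → ℝ := fun x => (N : ℝ)⁻¹ * ∑ j ∈ Finset.range N, f j x with hφ
  have hφs : ContDiff ℝ (⊤ : ℕ∞) φ := contDiff_const.mul (ContDiff.sum fun j _ => hfs j)
  have hz : ∀ x, 2 ^ N ≤ ‖x‖ → φ x = 0 := by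
    intro x hx
    simp only [hφ]
    rw [Finset.sum_eq_zero, mul_zero]
    intro j hj
    refine χ.zero_of_le_dist ?_
    rw [zero_add, dist_zero_right, norm_smul, norm_of_nonneg (ha0 _).le]
    have h1 : (2 : ℝ) ^ (j + 1) ≤ 2 ^ N :=
      pow_le_pow_right₀ (by norm_num) (Finset.mem_range.1 hj)
    simp only [ha]
    rw [inv_mul_eq_div, le_div_iff₀ (by positivity)]
    rw [pow_succ] at h1
    linarith
  have hpφ : ∀ i x, pd i φ x = (N : ℝ)⁻¹ * ∑ j ∈ Finset.range N, pd i (f j) x := by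
    intro i x
    have h1 : DifferentiableAt ℝ (fun x => ∑ j ∈ Finset.range N, f j x) x :=
      DifferentiableAt.fun_sum fun j _ => hfd j x
    rw [hφ, pd_const_mul h1]
    congr 1
    simp only [pd]
    rw [fderiv_fun_sum fun j _ => hfd j x]
    simp
  have hsq : ∀ x, ‖gradient φ x‖ ^ 2 =
      (N : ℝ)⁻¹ ^ 2 * ∑ j ∈ Finset.range N, ∑ i : Fin 2, (a j * pd i χ (0 + a j • x)) ^ 2 := by
    intro x
    rw [norm_gradient_sq, Finset.sum_comm, Finset.mul_sum]
    refine Finset.sum_congr rfl fun i _ => ?_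
    rw [hpφ, mul_pow, pow_two (∑ j ∈ Finset.range N, pd i (f j) x), Finset.sum_mul_sum]
    congr 1
    refine Finset.sum_congr rfl fun j hj => ?_
    rw [Finset.sum_eq_single j (fun k _ hk => hdisj i x j k hk.symm) (fun h => absurd hj h),
      hpf, pow_two]
  have hInt : ∀ j, ∫ x, ∑ i : Fin 2, (a j * pd i χ (0 + a j • x)) ^ 2 = E := by
    intro j
    simp only [mul_pow, ← Finset.mul_sum]
    rw [integral_const_mul, integral_comp_affine (fun x => ∑ i : Fin 2, pd i χ x ^ 2) 0 (ha0 j),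
      ← mul_assoc, mul_inv_cancel₀ (by have := ha0 j; positivity), one_mul]
  have hI : Integrable fun x => ∑ i : Fin 2, pd i χ x ^ 2 := by
    refine integrable_finsetSum _ fun i _ => ?_
    have h1 := continuous_pd hχ1 i
    have h2 : HasCompactSupport (pd i χ) := hasCompactSupport_pd hχc i
    simp only [pow_two]
    exact (h1.mul h1).integrable_of_hasCompactSupport h2.mul_left
  have hIj : ∀ j, Integrable fun x => ∑ i : Fin 2, (a j * pd i χ (0 + a j • x)) ^ 2 := by
    intro j
    simp only [mul_pow, ← Finset.mul_sum, zero_add]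
    exact (hI.comp_smul (ha0 j).ne').const_mul _
  refine ⟨2 ^ N + 1, by have : (0 : ℝ) < 2 ^ N := by positivity
                        linarith, φ, hφs, hasCompactSupport_of_norm_ge hz, ?_, ?_, ?_⟩
  · refine (closure_minimal (t := closedBall (0 : R2) (2 ^ N)) (fun x hx => ?_)
      isClosed_closedBall).trans (closedBall_subset_ball (by linarith))
    by_contra h
    exact hx (hz x (by simpa using (not_le.1 (by simpa using h)).le))
  · intro x hx
    have h1 : ∀ j, f j x = 1 := by
      intro j
      refine χ.one_of_mem_closedBall ?_
      rw [zero_add, mem_closedBall_zero_iff, norm_smul, norm_of_nonneg (ha0 _).le]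
      have h2 : a j ≤ 1 := inv_le_one_of_one_le₀ (one_le_pow₀ (by norm_num))
      have h3 : ‖x‖ < 1 := by simpa using hx
      change a j * ‖x‖ ≤ 1
      nlinarith [norm_nonneg x, ha0 j]
    simp only [hφ, h1]
    simp [hN0.ne']
  · simp only [hsq]
    rw [integral_const_mul, integral_finsetSum _ fun j _ => hIj j]
    simp only [hInt, Finset.sum_const, Finset.card_range, nsmul_eq_mul]
    have h1 : E / η < N := by linarith
    rw [div_lt_iff₀ hη] at h1
    have h2 : (N : ℝ)⁻¹ ^ 2 * (N * E) = E / N := by field_simp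
    rw [h2, div_lt_iff₀ hN0]
    linarith

theorem pd_comm {f : R2 → ℝ} (hf : ContDiff ℝ 2 f) (i j : Fin 2) (x : R2) :
    pd i (pd j f) x = pd j (pd i f) x := by
  have hd : DifferentiableAt ℝ (fderiv ℝ f) x :=
    (hf.fderiv_right (m := 1) (by norm_num [one_add_one_eq_two])).differentiable (by norm_num) x
  have key : ∀ i j : Fin 2, pd i (pd j f) x =
      fderiv ℝ (fderiv ℝ f) x (EuclideanSpace.single i 1) (EuclideanSpace.single j 1) := by
    intro i j
    have h := (hd.hasFDerivAt.clm_apply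
      (hasFDerivAt_const (EuclideanSpace.single j (1 : ℝ) : R2) x)).fderiv
    change fderiv ℝ (fun y => fderiv ℝ f y (EuclideanSpace.single j 1)) x _ = _
    rw [h]
    simp
  rw [key, key]
  exact (hf.contDiffAt.isSymmSndFDerivAt (by simp)) _ _

theorem pd_coord (i j : Fin 2) (x : R2) : pd i (fun y : R2 => y j) x = if i = j then 1 else 0 := by
  have h : fderiv ℝ (fun y : R2 => y j) x = EuclideanSpace.proj j :=
    (EuclideanSpace.proj j : R2 →L[ℝ] ℝ).fderiv
  rw [pd, h]
  simp [eq_comm]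

theorem contDiff_coord {n : WithTop ℕ∞} (j : Fin 2) : ContDiff ℝ n fun y : R2 => y j :=
  (EuclideanSpace.proj j : R2 →L[ℝ] ℝ).contDiff

theorem integral_coord_mul_pd {f : R2 → ℝ} (hf : ContDiff ℝ 1 f) (hc : HasCompactSupport f) :
    ∫ x : R2, 2 * (x 0 * f x * pd 0 f x) = - ∫ x, f x ^ 2 := by
  have hx : ContDiff ℝ 1 fun y : R2 => y 0 := contDiff_coord 0
  have h := integral_mul_pd (hx.mul hf) hf hc 0
  have h0 := hf.continuous
  have hx0 := hx.continuous
  have h1 := continuous_pd hf 0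
  have e : ∀ x, pd 0 (fun y : R2 => y 0 * f y) x * f x = f x ^ 2 + x 0 * f x * pd 0 f x := by
    intro x
    rw [pd_mul (hx.differentiable (by norm_num) x) (hf.differentiable (by norm_num) x), pd_coord]
    simp
    ring
  simp only [e] at h
  rw [integral_add] at h
  · rw [integral_const_mul]
    linarith
  · simp only [pow_two]
    exact (h0.mul h0).integrable_of_hasCompactSupport hc.mul_left
  · exact ((hx0.mul h0).mul h1).integrable_of_hasCompactSupport hc.mul_left.mul_right

theorem integral_pd_mul_pd_comm {f g : R2 → ℝ} (hf : ContDiff ℝ 2 f) (hg : ContDiff ℝ 2 g)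
    (hgc : HasCompactSupport g) :
    ∫ x, pd 1 f x * pd 0 g x = ∫ x, pd 0 f x * pd 1 g x := by
  have hfi : ∀ i, ContDiff ℝ 1 (pd i f) := fun i =>
    contDiff_pd hf (by norm_num [one_add_one_eq_two]) i
  have hg1 : ContDiff ℝ 1 g := hg.of_le (by norm_num)
  rw [integral_mul_pd (hfi 1) hg1 hgc, integral_mul_pd (hfi 0) hg1 hgc]
  simp only [pd_comm hf 1 0]

/-- A Carleman type inequality for the Cauchy–Riemann operator. -/
theorem carleman_conjugated {f g : R2 → ℝ} (hf : ContDiff ℝ 2 f) (hg : ContDiff ℝ 2 g)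
    (hfc : HasCompactSupport f) (hgc : HasCompactSupport g) (τ : ℝ) :
    τ * ∫ x, (f x ^ 2 + g x ^ 2) ≤
      ∫ x : R2, ((pd 0 f x - τ * x 0 * f x - pd 1 g x) ^ 2 +
        (pd 0 g x - τ * x 0 * g x + pd 1 f x) ^ 2) := by
  have hf1 : ContDiff ℝ 1 f := hf.of_le (by norm_num)
  have hg1 : ContDiff ℝ 1 g := hg.of_le (by norm_num)
  have cf := hf.continuous
  have cg := hg.continuous
  have cfi := continuous_pd hf1
  have cgi := continuous_pd hg1
  have cf0 := cfi 0
  have cf1 := cfi 1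
  have cg0 := cgi 0
  have cg1 := cgi 1
  have hfi := hasCompactSupport_pd hfc
  have hgi := hasCompactSupport_pd hgc
  have cx : Continuous fun y : R2 => y 0 := (contDiff_coord (n := 0) 0).continuous
  have if2 : Integrable fun x => f x ^ 2 := by
    simp only [pow_two]
    exact (cf.mul cf).integrable_of_hasCompactSupport hfc.mul_left
  have ig2 : Integrable fun x => g x ^ 2 := by
    simp only [pow_two]
    exact (cg.mul cg).integrable_of_hasCompactSupport hgc.mul_left
  have i1 : Integrable fun x : R2 => 2 * (x 0 * f x * pd 0 f x) :=
    Continuous.integrable_of_hasCompactSupport (by fun_prop) (hfi 0).mul_left.mul_left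
  have i2 : Integrable fun x : R2 => 2 * (x 0 * g x * pd 0 g x) :=
    Continuous.integrable_of_hasCompactSupport (by fun_prop) (hgi 0).mul_left.mul_left
  have i3 : Integrable fun x : R2 => pd 1 f x * pd 0 g x :=
    Continuous.integrable_of_hasCompactSupport (by fun_prop) (hgi 0).mul_left
  have i4 : Integrable fun x : R2 => pd 0 f x * pd 1 g x :=
    Continuous.integrable_of_hasCompactSupport (by fun_prop) (hgi 1).mul_left
  have e1 : τ * ∫ x, (f x ^ 2 + g x ^ 2) =
      ∫ x : R2, ((-τ) * (2 * (x 0 * f x * pd 0 f x) + 2 * (x 0 * g x * pd 0 g x)) +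
        2 * (pd 1 f x * pd 0 g x - pd 0 f x * pd 1 g x)) := by
    have j1 : Integrable fun x : R2 =>
        (-τ) * (2 * (x 0 * f x * pd 0 f x) + 2 * (x 0 * g x * pd 0 g x)) := (i1.add i2).const_mul _
    have j2 : Integrable fun x : R2 => 2 * (pd 1 f x * pd 0 g x - pd 0 f x * pd 1 g x) :=
      (i3.sub i4).const_mul _
    rw [integral_add j1 j2, integral_const_mul, integral_const_mul, integral_add i1 i2, integral_sub i3 i4, integral_add if2 ig2,
      integral_coord_mul_pd hf1 hfc, integral_coord_mul_pd hg1 hgc,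
      integral_pd_mul_pd_comm hf hg hgc]
    ring
  rw [e1]
  refine integral_mono (((i1.add i2).const_mul _).add ((i3.sub i4).const_mul _)) ?_ fun x => ?_
  · refine Continuous.integrable_of_hasCompactSupport (by fun_prop) ?_
    have h1 : HasCompactSupport fun x : R2 => pd 0 f x - τ * x 0 * f x - pd 1 g x :=
      ((hfi 0).sub hfc.mul_left).sub (hgi 1)
    have h2 : HasCompactSupport fun x : R2 => pd 0 g x - τ * x 0 * g x + pd 1 f x :=
      ((hgi 0).sub hgc.mul_left).add (hfi 1)
    simp only [pow_two]
    exact h1.mul_left.add h2.mul_left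
  · simp only
    nlinarith [sq_nonneg (pd 0 f x + τ * x 0 * f x + pd 1 g x),
      sq_nonneg (pd 0 g x + τ * x 0 * g x - pd 1 f x)]

/-- The weight in the Carleman inequality. -/
def carlemanWeight (τ : ℝ) (x : R2) : ℝ := exp (τ * x 0 ^ 2 / 2)

theorem contDiff_carlemanWeight {n : WithTop ℕ∞} (τ : ℝ) : ContDiff ℝ n (carlemanWeight τ) :=
  ((contDiff_const.mul ((contDiff_coord 0).pow 2)).div_const 2).exp

theorem pd_carlemanWeight (τ : ℝ) (i : Fin 2) (x : R2) :
    pd i (carlemanWeight τ) x = if i = 0 then τ * x 0 * carlemanWeight τ x else 0 := by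
  have hF : HasDerivAt (fun t : ℝ => exp (τ * t ^ 2 / 2)) (exp (τ * x 0 ^ 2 / 2) * (τ * x 0))
      (x 0) := by
    have h1 : HasDerivAt (fun t : ℝ => τ * t ^ 2 / 2) (τ * x 0) (x 0) := by
      refine (((hasDerivAt_pow 2 (x 0)).const_mul τ).div_const 2).congr_deriv ?_
      push_cast; ring
    exact h1.exp
  have h := pd_comp (f := fun y : R2 => y 0)
    ((contDiff_coord (n := 1) 0).differentiable (by norm_num) x) hF i
  rw [pd_coord] at h
  change pd i (carlemanWeight τ) x = _ at h
  rw [h]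
  split_ifs
  · simp only [carlemanWeight]; ring
  · simp

theorem carleman {f g : R2 → ℝ} (hf : ContDiff ℝ 2 f) (hg : ContDiff ℝ 2 g)
    (hfc : HasCompactSupport f) (hgc : HasCompactSupport g) (τ : ℝ) :
    τ * ∫ x, carlemanWeight τ x ^ 2 * (f x ^ 2 + g x ^ 2) ≤
      ∫ x : R2, carlemanWeight τ x ^ 2 * ((pd 0 f x - pd 1 g x) ^ 2 +
        (pd 0 g x + pd 1 f x) ^ 2) := by
  have hw : ContDiff ℝ 2 (carlemanWeight τ) := contDiff_carlemanWeight τ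
  have hp : ∀ {h : R2 → ℝ}, ContDiff ℝ 2 h → ∀ i x, pd i (fun y => carlemanWeight τ y * h y) x =
      carlemanWeight τ x * pd i h x +
        (if i = 0 then τ * x 0 * carlemanWeight τ x else 0) * h x := fun {h} hh i x => by
    rw [pd_mul (hw.differentiable (by norm_num) x) (hh.differentiable (by norm_num) x),
      pd_carlemanWeight]
  have h := carleman_conjugated (hw.mul hf) (hw.mul hg) hfc.mul_left hgc.mul_left τ
  simp only [hp hf, hp hg] at h
  convert h using 1
  · congr 1
    refine integral_congr_ae (Eventually.of_forall fun x => ?_)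
    simp only
    ring
  · refine integral_congr_ae (Eventually.of_forall fun x => ?_)
    simp only [if_true, one_ne_zero, if_false]
    ring

/-- A test function with `|Δψ| ≤ |ψ|` almost everywhere vanishes. -/
theorem eq_zero_of_abs_lap_le {ψ : R2 → ℝ} (hψ : ContDiff ℝ 3 ψ) (hc : HasCompactSupport ψ)
    (h : ∀ᵐ x, |lap ψ x| ≤ |ψ x|) : ψ = 0 := by
  have h2 : ContDiff ℝ 2 ψ := hψ.of_le (by norm_num)
  have hp : ∀ i, ContDiff ℝ 2 (pd i ψ) := fun i => contDiff_pd hψ (by norm_num) i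
  have hpc := hasCompactSupport_pd hc
  have c1 := carleman h2 (g := fun _ => 0) contDiff_const hc HasCompactSupport.zero 2
  have c2 := carleman (hp 0) (hp 1).neg (hpc 0) (hpc 1).neg 2
  have hz : ∀ i x, pd i (fun _ : R2 => (0 : ℝ)) x = 0 := fun i x => by simp [pd]
  have hl : ∀ x, lap ψ x = pd 0 (pd 0 ψ) x + pd 1 (pd 1 ψ) x := fun x => by
    rw [lap_eq, Fin.sum_univ_two]
  have hw : Continuous (carlemanWeight 2) := (contDiff_carlemanWeight (n := 0) 2).continuous
  have cψ := hψ.continuous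
  have cl := continuous_lap h2
  have hI : Integrable fun x => carlemanWeight 2 x ^ 2 * ψ x ^ 2 := by
    simp only [pow_two (ψ _)]
    exact Continuous.integrable_of_hasCompactSupport (by fun_prop) hc.mul_left.mul_left
  have e1 : ∀ x, (pd 0 ψ x - pd 1 (fun _ : R2 => (0 : ℝ)) x) ^ 2 +
      (pd 0 (fun _ : R2 => (0 : ℝ)) x + pd 1 ψ x) ^ 2 = pd 0 ψ x ^ 2 + (- pd 1 ψ x) ^ 2 := by
    intro x; rw [hz, hz]; ring
  have e2 : ∀ x, (pd 0 (pd 0 ψ) x - pd 1 (fun y => - pd 1 ψ y) x) ^ 2 +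
      (pd 0 (fun y => - pd 1 ψ y) x + pd 1 (pd 0 ψ) x) ^ 2 = lap ψ x ^ 2 := by
    intro x
    rw [pd_neg, pd_neg, hl, pd_comm h2 1 0]; ring
  have e3 : ∀ x, ψ x ^ 2 + (0 : ℝ) ^ 2 = ψ x ^ 2 := fun x => by ring
  simp only [e1, e3] at c1
  simp only [e2] at c2
  have c3 : ∫ x, carlemanWeight 2 x ^ 2 * lap ψ x ^ 2 ≤ ∫ x, carlemanWeight 2 x ^ 2 * ψ x ^ 2 := by
    refine integral_mono_ae ?_ hI (h.mono fun x hx => ?_)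
    · have hlc : HasCompactSupport (lap ψ) := by
        have : lap ψ = fun x => pd 0 (pd 0 ψ) x + pd 1 (pd 1 ψ) x := funext hl
        rw [this]
        exact (hasCompactSupport_pd (hpc 0) 0).add (hasCompactSupport_pd (hpc 1) 1)
      simp only [pow_two (lap ψ _)]
      exact Continuous.integrable_of_hasCompactSupport (by fun_prop) hlc.mul_left.mul_left
    · exact mul_le_mul_of_nonneg_left (sq_le_sq.2 hx) (sq_nonneg _)
  have hpos : ∀ x, 0 ≤ carlemanWeight 2 x ^ 2 * ψ x ^ 2 := fun x => by positivity
  have h0 : ∫ x, carlemanWeight 2 x ^ 2 * ψ x ^ 2 = 0 := by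
    have : 0 ≤ ∫ x, carlemanWeight 2 x ^ 2 * ψ x ^ 2 := integral_nonneg hpos
    linarith
  funext x
  by_contra hx
  have hx' : ψ x ≠ 0 := hx
  have hwx : carlemanWeight 2 x ≠ 0 := (exp_pos _).ne'
  have hcs : HasCompactSupport fun x => carlemanWeight 2 x ^ 2 * ψ x ^ 2 := by
    simp only [pow_two (ψ _)]
    exact hc.mul_left.mul_left
  have h4 : 0 < ∫ x, carlemanWeight 2 x ^ 2 * ψ x ^ 2 :=
    Continuous.integral_pos_of_hasCompactSupport_nonneg_nonzero (x := x) (by fun_prop) hcs hpos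
      (by positivity)
  linarith

/-- The quadratic form of the Schrödinger operator `-Δ - V`. -/
def schrodingerForm (V ψ : R2 → ℝ) : ℝ := ∫ x, (‖gradient ψ x‖ ^ 2 - V x * ψ x ^ 2)

/-- The bilinear form of the Schrödinger operator `-Δ - V`. -/
def schrodingerBilin (V φ ψ : R2 → ℝ) : ℝ :=
  ∫ x, ((∑ i : Fin 2, pd i φ x * pd i ψ x) - V x * (φ x * ψ x))

theorem CcSmoothIn.mono {S T : Set R2} {ψ : R2 → ℝ} (h : CcSmoothIn S ψ) (hST : S ⊆ T) :
    CcSmoothIn T ψ := ⟨h.1, h.2.1, h.2.2.trans hST⟩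

theorem CcSmoothIn.contDiff_nat {S : Set R2} {ψ : R2 → ℝ} (h : CcSmoothIn S ψ) (n : ℕ) :
    ContDiff ℝ n ψ := contDiff_infty.1 h.1 n

theorem CcSmoothIn.linear_comb {S : Set R2} {φ ψ : R2 → ℝ} (hφ : CcSmoothIn S φ)
    (hψ : CcSmoothIn S ψ) (a b : ℝ) : CcSmoothIn S fun x => a * φ x + b * ψ x := by
  refine ⟨(contDiff_const.mul hφ.1).add (contDiff_const.mul hψ.1),
    hφ.2.1.mul_left.add hψ.2.1.mul_left, ?_⟩
  refine (closure_minimal (fun x hx => ?_) ((isClosed_tsupport φ).union (isClosed_tsupport ψ))).trans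
    (union_subset hφ.2.2 hψ.2.2)
  by_contra h
  rw [mem_union, not_or] at h
  apply hx
  simp [image_eq_zero_of_notMem_tsupport h.1, image_eq_zero_of_notMem_tsupport h.2]

section
variable {U : Set R2} {V : R2 → ℝ}

theorem continuous_mul_of_ccSmoothIn (hU : IsOpen U) (hV : ContinuousOn V U) {ψ : R2 → ℝ}
    (hψ : CcSmoothIn U ψ) : Continuous fun x => ψ x * V x :=
  (contDiff_mul_of_tsupport_subset (n := 0) hU (hψ.1.of_le (by simp)) hψ.2.2
    (contDiffOn_zero.2 hV)).continuous

theorem integrable_potential (hU : IsOpen U) (hV : ContinuousOn V U) {φ ψ : R2 → ℝ}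
    (hφ : CcSmoothIn U φ) (hψ : CcSmoothIn U ψ) : Integrable fun x => V x * (φ x * ψ x) := by
  have h := continuous_mul_of_ccSmoothIn hU hV hφ
  have h2 := hψ.1.continuous
  have h3 : (fun x => V x * (φ x * ψ x)) = fun x => (φ x * V x) * ψ x := by funext x; ring
  rw [h3]
  exact (h.mul h2).integrable_of_hasCompactSupport hψ.2.1.mul_left

theorem integrable_sum_pd_mul {φ ψ : R2 → ℝ} (hφ : ContDiff ℝ 1 φ) (hψ : ContDiff ℝ 1 ψ)
    (hc : HasCompactSupport ψ) : Integrable fun x => ∑ i : Fin 2, pd i φ x * pd i ψ x :=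
  integrable_finsetSum _ fun i _ => ((continuous_pd hφ i).mul
    (continuous_pd hψ i)).integrable_of_hasCompactSupport (hasCompactSupport_pd hc i).mul_left

theorem schrodingerForm_eq (V ψ : R2 → ℝ) : schrodingerForm V ψ = schrodingerBilin V ψ ψ := by
  simp only [schrodingerForm, schrodingerBilin, norm_gradient_sq]
  simp only [pow_two]

theorem schrodingerForm_eq_sub (hU : IsOpen U) (hV : ContinuousOn V U) {ψ : R2 → ℝ}
    (hψ : CcSmoothIn U ψ) :
    schrodingerForm V ψ = (∫ x, ‖gradient ψ x‖ ^ 2) - ∫ x, V x * ψ x ^ 2 := by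
  have h1 : ContDiff ℝ 1 ψ := hψ.contDiff_nat 1
  rw [schrodingerForm, integral_sub]
  · simp only [norm_gradient_sq]
    simp only [pow_two]
    exact integrable_sum_pd_mul h1 h1 hψ.2.1
  · simp only [pow_two]
    exact integrable_potential hU hV hψ hψ

theorem schrodingerForm_linear_comb (hU : IsOpen U) (hV : ContinuousOn V U) {φ ψ : R2 → ℝ}
    (hφ : CcSmoothIn U φ) (hψ : CcSmoothIn U ψ) (a b : ℝ) :
    schrodingerForm V (fun x => a * φ x + b * ψ x) = a ^ 2 * schrodingerForm V φ +
      2 * a * b * schrodingerBilin V φ ψ + b ^ 2 * schrodingerForm V ψ := by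
  have hφ1 : ContDiff ℝ 1 φ := hφ.contDiff_nat 1
  have hψ1 : ContDiff ℝ 1 ψ := hψ.contDiff_nat 1
  have hI : ∀ {f g : R2 → ℝ}, CcSmoothIn U f → CcSmoothIn U g → ∀ c : ℝ, Integrable fun x =>
      c * ((∑ i : Fin 2, pd i f x * pd i g x) - V x * (f x * g x)) := fun {f g} hf hg c =>
    ((integrable_sum_pd_mul (hf.contDiff_nat 1) (hg.contDiff_nat 1) hg.2.1).sub
      (integrable_potential hU hV hf hg)).const_mul c
  have hI2 : Integrable fun x =>
      a ^ 2 * ((∑ i : Fin 2, pd i φ x * pd i φ x) - V x * (φ x * φ x)) +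
        2 * a * b * ((∑ i : Fin 2, pd i φ x * pd i ψ x) - V x * (φ x * ψ x)) :=
    (hI hφ hφ _).add (hI hφ hψ _)
  simp only [schrodingerForm_eq]
  simp only [schrodingerBilin]
  rw [← integral_const_mul, ← integral_const_mul, ← integral_const_mul,
    ← integral_add (hI hφ hφ _) (hI hφ hψ _), ← integral_add hI2 (hI hψ hψ _)]
  refine integral_congr_ae (Eventually.of_forall fun x => ?_)
  have hd : ∀ i, pd i (fun x => a * φ x + b * ψ x) x = a * pd i φ x + b * pd i ψ x := by
    intro i
    have d1 := hφ1.differentiable (by norm_num) x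
    have d2 := hψ1.differentiable (by norm_num) x
    rw [pd_add (d1.const_mul a) (d2.const_mul b), pd_const_mul d1, pd_const_mul d2]
  simp only [hd, Fin.sum_univ_two]
  ring

theorem schrodingerBilin_eq_zero {φ ψ : R2 → ℝ} (h : Disjoint (tsupport φ) (tsupport ψ)) :
    schrodingerBilin V φ ψ = 0 := by
  rw [schrodingerBilin]
  refine integral_eq_zero_of_ae (Eventually.of_forall fun x => ?_)
  by_cases hx : x ∈ tsupport φ
  · have hx2 : x ∉ tsupport ψ := h.notMem_of_mem_left hx
    simp [image_eq_zero_of_notMem_tsupport hx2,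
      image_eq_zero_of_notMem_tsupport fun h2 => hx2 (tsupport_pd_subset ψ _ h2)]
  · simp [image_eq_zero_of_notMem_tsupport hx,
      image_eq_zero_of_notMem_tsupport fun h2 => hx (tsupport_pd_subset φ _ h2)]

theorem schrodingerBilin_eq_integral_lap (hU : IsOpen U) (hV : ContinuousOn V U) {ψ η : R2 → ℝ}
    (hψ : CcSmoothIn U ψ) (hη : CcSmoothIn U η) :
    schrodingerBilin V ψ η = - ∫ x, η x * (lap ψ x + ψ x * V x) := by
  have hψ2 : ContDiff ℝ 2 ψ := hψ.contDiff_nat 2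
  have hη1 : ContDiff ℝ 1 η := hη.contDiff_nat 1
  have cη := hη1.continuous
  have hl := continuous_lap hψ2
  have hI : Integrable fun x => lap ψ x * η x :=
    (hl.mul cη).integrable_of_hasCompactSupport hη.2.1.mul_left
  rw [schrodingerBilin, integral_sub (integrable_sum_pd_mul (hψ2.of_le (by norm_num)) hη1 hη.2.1)
    (integrable_potential hU hV hψ hη), ← neg_neg (∫ x, ∑ i : Fin 2, pd i ψ x * pd i η x),
    ← integral_lap_mul hψ2 hη1 hη.2.1, ← neg_add', ← integral_add hI
      (integrable_potential hU hV hψ hη)]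
  congr 1
  refine integral_congr_ae (Eventually.of_forall fun x => ?_)
  simp only
  ring

theorem ae_lap_eq_of_schrodingerBilin_eq_zero {D : Set R2} (hD : IsOpen D) (hV : ContinuousOn V D)
    {ψ : R2 → ℝ} (hψ : CcSmoothIn D ψ)
    (h : ∀ η, CcSmoothIn D η → schrodingerBilin V ψ η = 0) :
    ∀ᵐ x, x ∈ D → lap ψ x + ψ x * V x = 0 := by
  have hψ2 : ContDiff ℝ 2 ψ := hψ.contDiff_nat 2
  have hc : Continuous fun x => lap ψ x + ψ x * V x :=
    (continuous_lap hψ2).add (continuous_mul_of_ccSmoothIn hD hV hψ)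
  refine hD.ae_eq_zero_of_integral_contDiff_smul_eq_zero
    (hc.locallyIntegrable.locallyIntegrableOn _) fun η hη hηc hηD => ?_
  have h1 := schrodingerBilin_eq_integral_lap hD hV hψ ⟨hη, hηc, hηD⟩
  rw [h η ⟨hη, hηc, hηD⟩] at h1
  simp only [smul_eq_mul]
  linarith

/-- If the Schrödinger form is not negative definite on any plane of test functions and is negative
at some test function `φ`, then it is positive on test functions supported away from `φ`. -/
theorem schrodingerForm_pos {D : Set R2} (hU : IsOpen U) (hV : ContinuousOn V U)
    (hV1 : ∀ x ∈ U, |V x| ≤ 1) (hD : IsOpen D) (hDU : D ⊆ U) {φ : R2 → ℝ}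
    (hφ : CcSmoothIn U φ) (hneg : schrodingerForm V φ < 0) (hdisj : Disjoint (tsupport φ) D)
    (hM : ¬ ∃ v w : R2 → ℝ, CcSmoothIn U v ∧ CcSmoothIn U w ∧ LinearIndependent ℝ ![v, w] ∧
      ∀ a b : ℝ, ¬(a = 0 ∧ b = 0) → schrodingerForm V (fun x => a * v x + b * w x) < 0)
    {ψ : R2 → ℝ} (hψ : CcSmoothIn D ψ) (hψ0 : ψ ≠ 0) : 0 < schrodingerForm V ψ := by
  have hnn : ∀ η, CcSmoothIn D η → 0 ≤ schrodingerForm V η := by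
    intro η hη
    by_contra hlt
    rw [not_le] at hlt
    have hcomb : ∀ a b : ℝ, ¬(a = 0 ∧ b = 0) →
        schrodingerForm V (fun x => a * φ x + b * η x) < 0 := by
      intro a b hab
      rw [schrodingerForm_linear_comb hU hV hφ (hη.mono hDU),
        schrodingerBilin_eq_zero (hdisj.mono_right hη.2.2)]
      rcases eq_or_ne a 0 with rfl | ha
      · have hb : b ≠ 0 := fun hb => hab ⟨rfl, hb⟩
        have := mul_neg_of_pos_of_neg (by positivity : 0 < b ^ 2) hlt
        linarith
      · have h1 := mul_neg_of_pos_of_neg (by positivity : 0 < a ^ 2) hneg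
        have h2 := mul_nonpos_of_nonneg_of_nonpos (sq_nonneg b) hlt.le
        linarith
    refine hM ⟨φ, η, hφ, hη.mono hDU, LinearIndependent.pair_iff.2 fun s t hst => ?_, hcomb⟩
    by_contra hab
    have h1 := hcomb s t hab
    have h2 : (fun x => s * φ x + t * η x) = fun _ => (0 : ℝ) := hst
    rw [h2] at h1
    simp [schrodingerForm] at h1
  refine lt_of_le_of_ne (hnn ψ hψ) fun h0 => hψ0 ?_
  have hb : ∀ η, CcSmoothIn D η → schrodingerBilin V ψ η = 0 := by
    intro η hη
    have hB := hnn η hη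
    set A := schrodingerBilin V ψ η
    set B := schrodingerForm V η
    have h1 := hnn _ (hψ.linear_comb hη 1 (-A / (B + 1)))
    rw [schrodingerForm_linear_comb hU hV (hψ.mono hDU) (hη.mono hDU), ← h0] at h1
    have h2 : 1 ^ 2 * 0 + 2 * 1 * (-A / (B + 1)) * A + (-A / (B + 1)) ^ 2 * B =
        - (A ^ 2 * ((B + 2) / (B + 1) ^ 2)) := by field_simp; ring
    rw [h2] at h1
    have h3 : 0 < (B + 2) / (B + 1) ^ 2 := by positivity
    have h4 : A ^ 2 = 0 := by nlinarith [sq_nonneg A]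
    exact pow_eq_zero_iff (two_ne_zero) |>.1 h4
  refine eq_zero_of_abs_lap_le (hψ.contDiff_nat 3) hψ.2.1 ?_
  filter_upwards [ae_lap_eq_of_schrodingerBilin_eq_zero hD (hV.mono hDU) hψ hb] with x hx
  by_cases hxD : x ∈ D
  · have h1 : lap ψ x = - (ψ x * V x) := by linarith [hx hxD]
    rw [h1, abs_neg, abs_mul]
    exact mul_le_of_le_one_right (abs_nonneg _) (hV1 x (hDU hxD))
  · have h1 : lap ψ x = 0 := by
      rw [lap_eq]
      refine Finset.sum_eq_zero fun i _ => image_eq_zero_of_notMem_tsupport fun h2 => hxD ?_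
      exact hψ.2.2 (tsupport_pd_subset _ _ (tsupport_pd_subset _ _ h2))
    rw [h1, abs_zero]
    exact abs_nonneg _

end

theorem IsSolution.contDiffAt {Ω : Set R2} {p : ℝ} {u : R2 → ℝ} (h : IsSolution Ω p u)
    (hop : IsOpen Ω) {x : R2} (hx : x ∈ Ω) : ContDiffAt ℝ 2 u x :=
  h.1.contDiffAt (hop.mem_nhds hx)

theorem IsSolution.abs_lap_le {Ω : Set R2} {p M : ℝ} {u : R2 → ℝ} (h : IsSolution Ω p u)
    (hp : 1 < p) (hM : 0 < M) {x : R2} (hx : x ∈ Ω) (hux : |u x| ≤ M) :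
    |lap u x| ≤ M * M ^ (p - 1) := by
  have h1 : lap u x = - (|u x| ^ (p - 1) * u x) := by linarith [h.2.2.1 x hx]
  rw [h1, abs_neg, abs_mul, abs_of_nonneg (rpow_nonneg (abs_nonneg _) _), mul_comm]
  exact mul_le_mul hux (rpow_le_rpow (abs_nonneg _) hux (by linarith))
    (rpow_nonneg (abs_nonneg _) _) hM.le

open Classical in
/-- The truncation `(2 u / M - 1)₊³`, extended by zero outside of `Ω`. -/
def superlevelTrunc (Ω : Set R2) (u : R2 → ℝ) (M : ℝ) (x : R2) : ℝ :=
  if x ∈ Ω then max (-1 + 2 * M⁻¹ * u x) 0 ^ 3 else 0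

section
variable {Ω : Set R2} {u : R2 → ℝ} {M p : ℝ}

theorem superlevelTrunc_of_mem {x : R2} (hx : x ∈ Ω) :
    superlevelTrunc Ω u M x = max (-1 + 2 * M⁻¹ * u x) 0 ^ 3 := if_pos hx

theorem superlevelTrunc_of_notMem {x : R2} (hx : x ∉ Ω) : superlevelTrunc Ω u M x = 0 := if_neg hx

theorem superlevelTrunc_nonneg (x : R2) : 0 ≤ superlevelTrunc Ω u M x := by
  unfold superlevelTrunc
  split_ifs
  · positivity
  · exact le_rfl

theorem superlevelTrunc_le_one (hM : 0 < M) (hle : ∀ x ∈ Ω, u x ≤ M) (x : R2) :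
    superlevelTrunc Ω u M x ≤ 1 := by
  unfold superlevelTrunc
  split_ifs with hx
  · refine pow_le_one₀ (le_max_right _ _) (max_le ?_ zero_le_one)
    have : M⁻¹ * u x ≤ 1 := by rw [inv_mul_le_iff₀ hM]; linarith [hle x hx]
    linarith
  · exact zero_le_one

theorem superlevelTrunc_eq_one (hM : 0 < M) {x : R2} (hx : x ∈ Ω) (hu : u x = M) :
    superlevelTrunc Ω u M x = 1 := by
  rw [superlevelTrunc_of_mem hx, hu, mul_assoc, inv_mul_cancel₀ hM.ne']
  norm_num

theorem superlevelTrunc_eventuallyEq_zero (hM : 0 < M) (hop : IsOpen Ω) (hsol : IsSolution Ω p u)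
    {x : R2} (hx : x ∉ Ω) : superlevelTrunc Ω u M =ᶠ[𝓝 x] fun _ => 0 := by
  by_cases hxc : x ∈ closure Ω
  · have hf : x ∈ frontier Ω := by rw [hop.frontier_eq]; exact ⟨hxc, hx⟩
    have hc : ContinuousWithinAt u (closure Ω) x := hsol.2.1.continuousOn x hxc
    have h1 : ∀ᶠ y in 𝓝[closure Ω] x, u y < M / 2 := by
      refine hc.eventually (gt_mem_nhds ?_)
      rw [hsol.2.2.2 x hf]; positivity
    filter_upwards [eventually_nhdsWithin_iff.1 h1] with y hy
    by_cases hyΩ : y ∈ Ω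
    · rw [superlevelTrunc_of_mem hyΩ, max_eq_right]
      · norm_num
      · have h2 := hy (subset_closure hyΩ)
        have h3 : M⁻¹ * u y ≤ 1 / 2 := by rw [inv_mul_le_iff₀ hM]; linarith
        linarith
    · exact superlevelTrunc_of_notMem hyΩ
  · filter_upwards [isClosed_closure.isOpen_compl.mem_nhds hxc] with y hy
    exact superlevelTrunc_of_notMem fun h => hy (subset_closure h)

theorem superlevelTrunc_eventuallyEq (hop : IsOpen Ω) {x : R2} (hx : x ∈ Ω) :
    superlevelTrunc Ω u M =ᶠ[𝓝 x] fun y => max (-1 + 2 * M⁻¹ * u y) 0 ^ 3 := by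
  filter_upwards [hop.mem_nhds hx] with y hy using superlevelTrunc_of_mem hy

theorem contDiff_superlevelTrunc (hM : 0 < M) (hop : IsOpen Ω) (hsol : IsSolution Ω p u) :
    ContDiff ℝ 2 (superlevelTrunc Ω u M) := by
  rw [contDiff_iff_contDiffAt]
  intro x
  by_cases hx : x ∈ Ω
  · refine ContDiffAt.congr_of_eventuallyEq ?_ (superlevelTrunc_eventuallyEq hop hx)
    have h1 : ContDiffAt ℝ 2 (fun y => -1 + 2 * M⁻¹ * u y) x :=
      contDiffAt_const.add (contDiffAt_const.mul (hsol.contDiffAt hop hx))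
    exact (contDiff_posPart_pow 2).contDiffAt.comp x h1
  · exact contDiffAt_const.congr_of_eventuallyEq (superlevelTrunc_eventuallyEq_zero hM hop hsol hx)

theorem hasCompactSupport_superlevelTrunc (hb : Bornology.IsBounded Ω) :
    HasCompactSupport (superlevelTrunc Ω u M) := by
  refine HasCompactSupport.of_support_subset_isCompact hb.isCompact_closure fun x hx => ?_
  by_contra h
  exact hx (superlevelTrunc_of_notMem fun h' => h (subset_closure h'))

theorem neg_le_lap_superlevelTrunc (hM : 0 < M) (hop : IsOpen Ω) (hp : 1 < p)
    (hsol : IsSolution Ω p u) (hle : ∀ x ∈ Ω, |u x| ≤ M) (x : R2) :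
    -(6 * M ^ (p - 1)) ≤ lap (superlevelTrunc Ω u M) x := by
  have hK : 0 < M ^ (p - 1) := rpow_pos_of_pos hM _
  by_cases hx : x ∈ Ω
  · rw [lap_congr (superlevelTrunc_eventuallyEq hop hx)]
    have hu := hsol.contDiffAt hop hx
    set v : R2 → ℝ := fun y => -1 + 2 * M⁻¹ * u y with hv
    have hvd : ContDiffAt ℝ 2 v x := contDiffAt_const.add (contDiffAt_const.mul hu)
    have hF' : HasDerivAt (fun t : ℝ => 3 * max t 0 ^ 2) (3 * (2 * max (v x) 0)) (v x) := by
      refine ((hasDerivAt_posPart_pow 0 (v x)).const_mul 3).congr_deriv ?_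
      push_cast; ring
    have hF : ∀ t : ℝ, HasDerivAt (fun t : ℝ => max t 0 ^ 3) (3 * max t 0 ^ 2) t := fun t => by
      refine (hasDerivAt_posPart_pow 1 t).congr_deriv ?_
      push_cast; ring
    rw [lap_comp (F := fun t => max t 0 ^ 3) hvd hF hF']
    have h1 : lap v x = 2 * M⁻¹ * lap u x := by
      rw [hv, lap_const_add, lap_const_mul hu]
    have h2 : |lap v x| ≤ 2 * M ^ (p - 1) := by
      rw [h1, abs_mul, abs_of_pos (by positivity)]
      have := hsol.abs_lap_le hp hM hx (hle x hx)
      calc 2 * M⁻¹ * |lap u x| ≤ 2 * M⁻¹ * (M * M ^ (p - 1)) := by gcongr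
        _ = _ := by field_simp
    have h3 : max (v x) 0 ≤ 1 := by
      refine max_le ?_ zero_le_one
      have : M⁻¹ * u x ≤ 1 := by
        rw [inv_mul_le_iff₀ hM]; linarith [(le_abs_self _).trans (hle x hx)]
      simp only [hv]
      linarith
    have h0 : 0 ≤ max (v x) 0 := le_max_right _ _
    have h4 : max (v x) 0 ^ 2 ≤ 1 := pow_le_one₀ h0 h3
    have h5 : 0 ≤ 3 * (2 * max (v x) 0) * ∑ i : Fin 2, pd i v x ^ 2 :=
      mul_nonneg (by positivity) (Finset.sum_nonneg fun i _ => sq_nonneg _)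
    have h6 : -(max (v x) 0 ^ 2 * (2 * M ^ (p - 1))) ≤ max (v x) 0 ^ 2 * lap v x := by
      rw [← mul_neg]
      exact mul_le_mul_of_nonneg_left (abs_le.1 h2).1 (sq_nonneg _)
    nlinarith
  · rw [lap_congr (superlevelTrunc_eventuallyEq_zero hM hop hsol hx)]
    have : lap (fun _ : R2 => (0 : ℝ)) x = 0 := by simp [lap]
    rw [this]
    linarith

/-- The maximum of a solution is bounded below. -/
theorem exists_lower_bound_max {Ω : Set R2} (hop : IsOpen Ω) (hb : Bornology.IsBounded Ω) :
    ∃ c > (0 : ℝ), ∀ (p M : ℝ) (u : R2 → ℝ) (x0 : R2), 1 < p → IsSolution Ω p u → x0 ∈ Ω →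
      0 < M → u x0 = M → (∀ x ∈ Ω, |u x| ≤ M) → c ≤ M ^ (p - 1) := by
  set v : ℝ := volume.real Ω with hv
  have hv0 : 0 ≤ v := measureReal_nonneg
  have hm := kerMass_pos
  set ρ : ℝ := sqrt ((2 * v + 1) / kerMass) with hρdef
  have hρ : 0 < ρ := sqrt_pos.2 (by positivity)
  have hρ2 : ρ ^ 2 * kerMass = 2 * v + 1 := by
    rw [hρdef, sq_sqrt (by positivity), div_mul_cancel₀ _ hm.ne']
  refine ⟨1 / (12 * ρ ^ 2), by positivity, fun p M u x0 hp hsol hx0 hM hux hle => ?_⟩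
  set G := superlevelTrunc Ω u M with hG
  have hGd : ContDiff ℝ 2 G := contDiff_superlevelTrunc hM hop hsol
  have hGc : HasCompactSupport G := hasCompactSupport_superlevelTrunc hb
  have hK : 0 < M ^ (p - 1) := rpow_pos_of_pos hM _
  have h1 := integral_one_sub_le hGd hGc hρ (by positivity)
    (neg_le_lap_superlevelTrunc hM hop hp hsol hle) (superlevelTrunc_eq_one hM hx0 hux)
  have hI1 : Integrable fun z => avKer (ρ⁻¹ • (z - x0)) := integrable_avKer_scaled x0 hρ
  have cG := hGd.continuous
  have ck := continuous_avKer
  have hI2 : Integrable fun z => G z * avKer (ρ⁻¹ • (z - x0)) :=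
    Continuous.integrable_of_hasCompactSupport (by fun_prop) hGc.mul_right
  have h2 : ∫ z, (1 - G z) * avKer (ρ⁻¹ • (z - x0)) =
      (∫ z, avKer (ρ⁻¹ • (z - x0))) - ∫ z, G z * avKer (ρ⁻¹ • (z - x0)) := by
    rw [← integral_sub hI1 hI2]
    refine integral_congr_ae (Eventually.of_forall fun z => ?_)
    simp only
    ring
  have hvf : volume Ω < ⊤ := hb.measure_lt_top
  have h3 : ∫ z, G z * avKer (ρ⁻¹ • (z - x0)) ≤ v := by
    calc ∫ z, G z * avKer (ρ⁻¹ • (z - x0)) ≤ ∫ z, Ω.indicator (fun _ => (1 : ℝ)) z := by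
          refine integral_mono hI2
            ((integrable_indicator_iff hop.measurableSet).2 (integrableOn_const hvf.ne)) fun z => ?_
          simp only
          by_cases hz : z ∈ Ω
          · rw [indicator_of_mem hz]
            exact mul_le_one₀ (superlevelTrunc_le_one hM (fun x hx => (le_abs_self _).trans (hle x hx)) z)
              (avKer_nonneg _) (avKer_le_one _)
          · rw [indicator_of_notMem hz, hG, superlevelTrunc_of_notMem hz, zero_mul]
      _ = v := by
          rw [integral_indicator hop.measurableSet, setIntegral_const]
          simp [hv]
  rw [h2, integral_avKer_scaled x0 hρ, hρ2] at h1
  have h4 : 6 * M ^ (p - 1) * ρ ^ 4 * kerMass = 6 * M ^ (p - 1) * ρ ^ 2 * (2 * v + 1) := by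
    rw [← hρ2]; ring
  rw [h4] at h1
  rw [div_le_iff₀ (by positivity)]
  have h5 : (2 * v + 1) * (1 / 2) ≤ (2 * v + 1) * (6 * M ^ (p - 1) * ρ ^ 2) := by linarith
  have h6 := le_of_mul_le_mul_left h5 (by positivity)
  linarith

theorem hasCompactSupport_comp_affine {f : R2 → ℝ} (hf : HasCompactSupport f) (b : R2) {a : ℝ}
    (ha : a ≠ 0) : HasCompactSupport fun x => f (b + a • x) :=
  hf.comp_homeomorph ((Homeomorph.smulOfNeZero a ha).trans (Homeomorph.addLeft b))

/-- A ball around the maximum point of a solution is contained in `Ω` if its radius `d` and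
`d² M ^ (p - 1)` are both small. -/
theorem exists_closedBall_subset {Ω : Set R2} (hop : IsOpen Ω) (hb : Bornology.IsBounded Ω)
    (hsm : SmoothBoundary Ω) :
    ∃ κ > (0 : ℝ), ∀ (p M d : ℝ) (u : R2 → ℝ) (x0 : R2), 1 < p → IsSolution Ω p u → x0 ∈ Ω →
      0 < M → u x0 = M → (∀ x ∈ Ω, |u x| ≤ M) → 0 < d → d < κ → d ^ 2 * M ^ (p - 1) < κ →
      closedBall x0 d ⊆ Ω := by
  obtain ⟨s₀, hs₀, hfr⟩ := exists_frontier_dist_eq hb hsm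
  obtain ⟨δ₀, hδ₀, hdef⟩ := exists_lower_bound_defect
  refine ⟨min (s₀ / 2) (δ₀ / 6), by positivity, ?_⟩
  intro p M d u x0 hp hsol hx0 hM hux hle hd0 hd hdK
  have hds : d < s₀ / 2 := hd.trans_le (min_le_left _ _)
  have hdK' : d ^ 2 * M ^ (p - 1) < δ₀ / 6 := hdK.trans_le (min_le_right _ _)
  by_contra hsub
  have hpc : IsPreconnected (closedBall x0 d) := (convex_closedBall x0 d).isPreconnected
  obtain ⟨y, hyb, hyf⟩ : (closedBall x0 d ∩ frontier Ω).Nonempty := by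
    by_contra hemp
    rw [not_nonempty_iff_eq_empty, ← disjoint_iff_inter_eq_empty] at hemp
    refine hsub (hpc.subset_of_closure_inter_subset hop ⟨x0, mem_closedBall_self hd0.le, hx0⟩ ?_)
    intro z hz
    by_contra hzΩ
    exact hemp.notMem_of_mem_left hz.2 (hop.frontier_eq ▸ ⟨hz.1, hzΩ⟩)
  have hyΩ : y ∉ Ω := by
    rw [hop.frontier_eq] at hyf
    exact hyf.2
  set t : ℝ := dist x0 y with ht
  have ht0 : 0 < t := dist_pos.2 fun h => hyΩ (h ▸ hx0)
  have htd : t ≤ d := by rw [ht, dist_comm]; exact hyb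
  set G := superlevelTrunc Ω u M with hG
  have hGd : ContDiff ℝ 2 G := contDiff_superlevelTrunc hM hop hsol
  have hGc : HasCompactSupport G := hasCompactSupport_superlevelTrunc hb
  have hK : 0 < M ^ (p - 1) := rpow_pos_of_pos hM _
  have h := hdef (fun x => G (y + t • x)) (t⁻¹ • (x0 - y)) (6 * (t ^ 2 * M ^ (p - 1)))
    (hGd.comp (contDiff_const.add (contDiff_id.const_smul t)))
    (hasCompactSupport_comp_affine hGc y ht0.ne') (fun x => superlevelTrunc_nonneg _)
    (fun x => superlevelTrunc_le_one hM (fun x hx => (le_abs_self _).trans (hle x hx)) _)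
    (by rw [norm_smul, ← dist_eq_norm, ← ht, norm_of_nonneg (by positivity),
      inv_mul_cancel₀ ht0.ne'])
    (by
      rw [smul_inv_smul₀ ht0.ne', add_sub_cancel]
      exact superlevelTrunc_eq_one hM hx0 hux)
    (by positivity)
    (fun x => by
      rw [lap_comp_affine hGd.contDiffAt]
      have := neg_le_lap_superlevelTrunc hM hop hp hsol hle (y + t • x)
      nlinarith [sq_nonneg t])
    (fun s hs => by
      obtain ⟨z, hzf, hz⟩ := hfr y hyf (s * t) (by nlinarith [hs.1]) (by nlinarith [hs.2])
      refine ⟨t⁻¹ • (z - y), ?_, ?_⟩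
      · rw [norm_smul, ← dist_eq_norm, hz, norm_of_nonneg (by positivity)]
        field_simp
      · rw [smul_inv_smul₀ ht0.ne', add_sub_cancel]
        refine superlevelTrunc_of_notMem ?_
        rw [hop.frontier_eq] at hzf
        exact hzf.2)
  have h2 : t ^ 2 * M ^ (p - 1) ≤ d ^ 2 * M ^ (p - 1) := by gcongr
  linarith

/-- Interior bound at the scale of the equation. -/
theorem one_sub_le_of_closedBall_subset (hp : 1 < p) (hop : IsOpen Ω) (hsol : IsSolution Ω p u)
    (hM : 0 < M) {x0 : R2} (hux : u x0 = M) (hle : ∀ x ∈ Ω, |u x| ≤ M) {d : ℝ} (hd : 0 < d)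
    (hsub : closedBall x0 (6 * d) ⊆ Ω) {y : R2} (hy : ‖y - x0‖ ≤ d) :
    1 - M⁻¹ * u y ≤ 344 * d ^ 2 * M ^ (p - 1) := by
  set U : Set R2 := {x | x0 + (2 * d) • x ∈ Ω} with hU
  have hUo : IsOpen U := hop.preimage (f := fun x : R2 => x0 + (2 * d) • x) (by fun_prop)
  have hK : 0 < M ^ (p - 1) := rpow_pos_of_pos hM _
  have huc : ∀ x ∈ U, ContDiffAt ℝ 2 (fun x => u (x0 + (2 * d) • x)) x := fun x hx =>
    (hsol.contDiffAt hop hx).comp x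
      (contDiff_const.add (contDiff_id.const_smul (2 * d))).contDiffAt
  have h := le_of_lap_bounded (W := fun x => 1 + -M⁻¹ * u (x0 + (2 * d) • x)) (U := U)
    (C := 4 * d ^ 2 * M ^ (p - 1)) hUo (fun x hx => hsub ?_)
    (fun x hx => (contDiffAt_const.add (contDiffAt_const.mul (huc x hx))).contDiffWithinAt)
    (fun x hx => ?_) ?_ (fun x hx => ?_) (x := (2 * d)⁻¹ • (y - x0)) ?_
  · rw [smul_inv_smul₀ (by positivity), add_sub_cancel] at h
    linarith
  · rw [mem_closedBall, dist_eq_norm, add_sub_cancel_left, norm_smul,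
      norm_of_nonneg (by positivity)]
    have : ‖x‖ ≤ 3 := by simpa using hx
    nlinarith
  · have h1 : M⁻¹ * u (x0 + (2 * d) • x) ≤ 1 := by
      rw [inv_mul_le_iff₀ hM]; linarith [(le_abs_self _).trans (hle _ hx)]
    linarith
  · simp [hux, hM.ne']
  · rw [lap_const_add, lap_const_mul (huc x hx), lap_comp_affine (hsol.contDiffAt hop hx)]
    have h1 := hsol.abs_lap_le hp hM hx (hle _ hx)
    rw [abs_mul, abs_mul, abs_neg, abs_of_pos (inv_pos.2 hM), abs_of_nonneg (sq_nonneg _)]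
    calc M⁻¹ * ((2 * d) ^ 2 * |lap u (x0 + (2 * d) • x)|)
        ≤ M⁻¹ * ((2 * d) ^ 2 * (M * M ^ (p - 1))) := by gcongr
      _ = _ := by field_simp; ring
  · rw [mem_closedBall_zero_iff, norm_smul, norm_of_nonneg (by positivity)]
    rw [inv_mul_le_iff₀ (by positivity)]
    linarith

end

theorem schrodingerForm_comp_affine (P w : R2 → ℝ) (x0 : R2) {ε : ℝ} (hε : 0 < ε) :
    schrodingerForm (fun x => ε ^ 2 * P (x0 + ε • x)) (fun x => w (x0 + ε • x)) =
      schrodingerForm P w := by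
  have h : ∀ x, ‖gradient (fun x => w (x0 + ε • x)) x‖ ^ 2 -
      ε ^ 2 * P (x0 + ε • x) * w (x0 + ε • x) ^ 2 =
      ε ^ 2 * (fun z => ‖gradient w z‖ ^ 2 - P z * w z ^ 2) (x0 + ε • x) := by
    intro x
    simp only [norm_gradient_sq, pd_comp_affine, mul_pow, ← Finset.mul_sum]
    ring
  rw [schrodingerForm, schrodingerForm]
  simp only [h]
  rw [integral_const_mul, integral_comp_affine (fun z => ‖gradient w z‖ ^ 2 - P z * w z ^ 2) x0 hε,
    mul_inv_cancel_left₀ (by positivity)]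

theorem CcSmoothIn.comp_affine {S T : Set R2} {v : R2 → ℝ} (hv : CcSmoothIn S v) (b : R2) {a : ℝ}
    (ha : a ≠ 0) (hST : ∀ x, b + a • x ∈ S → x ∈ T) : CcSmoothIn T fun x => v (b + a • x) := by
  refine ⟨hv.1.comp (contDiff_const.add (contDiff_id.const_smul a)),
    hasCompactSupport_comp_affine hv.2.1 b ha, fun x hx => hST x (hv.2.2 ?_)⟩
  exact tsupport_comp_subset_preimage v (f := fun x : R2 => b + a • x) (by fun_prop) hx

/-- A Schrödinger form that is not negative definite on any plane keeps this property under
rescaling. -/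
theorem not_exists_plane_comp_affine {S T : Set R2} {P : R2 → ℝ} (x0 : R2) {ε : ℝ} (hε : 0 < ε)
    (hST : ∀ x, x ∈ T ↔ x0 + ε • x ∈ S)
    (h : ¬ ∃ v w : R2 → ℝ, CcSmoothIn S v ∧ CcSmoothIn S w ∧ LinearIndependent ℝ ![v, w] ∧
      ∀ a b : ℝ, ¬(a = 0 ∧ b = 0) → schrodingerForm P (fun x => a * v x + b * w x) < 0) :
    ¬ ∃ v w : R2 → ℝ, CcSmoothIn T v ∧ CcSmoothIn T w ∧ LinearIndependent ℝ ![v, w] ∧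
      ∀ a b : ℝ, ¬(a = 0 ∧ b = 0) →
        schrodingerForm (fun x => ε ^ 2 * P (x0 + ε • x)) (fun x => a * v x + b * w x) < 0 := by
  rintro ⟨v, w, hv, hw, -, hneg⟩
  have hinv : ∀ x, x0 + ε • (-(ε⁻¹ • x0) + ε⁻¹ • x) = x := fun x => by
    rw [smul_add, smul_neg, smul_inv_smul₀ hε.ne', smul_inv_smul₀ hε.ne', add_neg_cancel_left]
  have hinv2 : ∀ x, -(ε⁻¹ • x0) + ε⁻¹ • (x0 + ε • x) = x := fun x => by
    rw [smul_add, inv_smul_smul₀ hε.ne', neg_add_cancel_left]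
  have hmem : ∀ x, -(ε⁻¹ • x0) + ε⁻¹ • x ∈ T → x ∈ S := fun x hx => by
    rwa [hST, hinv] at hx
  have hneg' : ∀ a b : ℝ, ¬(a = 0 ∧ b = 0) → schrodingerForm P (fun x =>
      a * v (-(ε⁻¹ • x0) + ε⁻¹ • x) + b * w (-(ε⁻¹ • x0) + ε⁻¹ • x)) < 0 := by
    intro a b hab
    have h1 := hneg a b hab
    rw [← schrodingerForm_comp_affine P _ x0 hε]
    simpa only [hinv2] using h1
  refine h ⟨_, _, hv.comp_affine _ (inv_ne_zero hε.ne') hmem,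
    hw.comp_affine _ (inv_ne_zero hε.ne') hmem, ?_, hneg'⟩
  rw [LinearIndependent.pair_iff]
  intro a b hab
  by_contra hne
  have h1 := hneg' a b hne
  have h2 : (fun x => a * v (-(ε⁻¹ • x0) + ε⁻¹ • x) + b * w (-(ε⁻¹ • x0) + ε⁻¹ • x)) =
      fun _ => (0 : ℝ) := hab
  rw [h2] at h1
  simp [schrodingerForm, gradient] at h1

theorem exp_neg_two_mul_le_one_sub {t : ℝ} (h0 : 0 ≤ t) (h1 : t ≤ 1 / 2) :
    exp (-(2 * t)) ≤ 1 - t := by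
  rw [exp_neg, inv_le_comm₀ (exp_pos _) (by linarith)]
  refine le_trans ?_ (add_one_le_exp (2 * t))
  rw [inv_le_iff_one_le_mul₀ (by linarith)]
  nlinarith

theorem exp_neg_le_rpow {p a s : ℝ} (hp : 1 < p) (ha : 0 ≤ a) (hap : 2 * a ≤ p)
    (hs : 1 - s ≤ a / p) : exp (-(2 * a)) ≤ s ^ (p - 1) := by
  have hp0 : 0 < p := by linarith
  have h1 : exp (-(2 * (a / p))) ≤ s :=
    (exp_neg_two_mul_le_one_sub (by positivity) (by rw [div_le_iff₀ hp0]; linarith)).trans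
      (by linarith)
  calc exp (-(2 * a)) ≤ exp (-(2 * (a / p)) * (p - 1)) := by
        refine exp_le_exp.2 ?_
        have : a / p * p = a := by field_simp
        have : 0 ≤ a / p := by positivity
        nlinarith
    _ = exp (-(2 * (a / p))) ^ (p - 1) := exp_mul _ _
    _ ≤ s ^ (p - 1) := by gcongr

/-- Lower bound for a weighted integral of the square of a function that is one on the unit
ball. -/
theorem mul_volume_ball_le_integral {U : Set R2} {V φ : R2 → ℝ} (hU : IsOpen U)
    (hV : ContinuousOn V U) (hV0 : ∀ x, 0 ≤ V x) (hφ : CcSmoothIn U φ)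
    (hφ1 : ∀ x ∈ ball (0 : R2) 1, φ x = 1) {c : ℝ} (hVc : ∀ x ∈ ball (0 : R2) 1, c ≤ V x) :
    c * volume.real (ball (0 : R2) 1) ≤ ∫ x, V x * φ x ^ 2 := by
  have hI : Integrable fun x => V x * φ x ^ 2 := by
    simpa only [pow_two] using integrable_potential hU hV hφ hφ
  calc c * volume.real (ball (0 : R2) 1) = ∫ x in ball (0 : R2) 1, c := by
        rw [setIntegral_const, smul_eq_mul, mul_comm]
    _ ≤ ∫ x in ball (0 : R2) 1, V x * φ x ^ 2 := by
        refine setIntegral_mono_on (integrableOn_const measure_ball_lt_top.ne) hI.integrableOn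
          measurableSet_ball fun x hx => ?_
        rw [hφ1 x hx, one_pow, mul_one]
        exact hVc x hx
    _ ≤ ∫ x, V x * φ x ^ 2 := setIntegral_le_integral hI
        (Eventually.of_forall fun x => mul_nonneg (hV0 x) (sq_nonneg _))

/-- Radii comparable to `ε` are eventually small enough for the interior bounds. -/
theorem eventually_scale_small {c κ r : ℝ} (hc : 0 < c) (hκ : 0 < κ) :
    ∀ᶠ p : ℝ in atTop, 36 * r ^ 2 / (p * c) < κ ^ 2 ∧ 36 * r ^ 2 / p < κ ∧ 344 * r ^ 2 < p ∧
      688 ≤ p := by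
  have h1 : Tendsto (fun p : ℝ => 36 * r ^ 2 / (p * c)) atTop (𝓝 0) :=
    (tendsto_id.atTop_mul_const hc).const_div_atTop _
  have h2 : Tendsto (fun p : ℝ => 36 * r ^ 2 / p) atTop (𝓝 0) :=
    tendsto_id.const_div_atTop _
  filter_upwards [h1.eventually_lt_const (pow_pos hκ 2), h2.eventually_lt_const hκ,
    eventually_gt_atTop _, eventually_ge_atTop _] with p a b c d
  exact ⟨a, b, c, d⟩

theorem stmt16
    (Ω : Set R2) (hne : Ω.Nonempty) (hop : IsOpen Ω)
    (hbdd : Bornology.IsBounded Ω) (hconn : IsConnected Ω) (hsm : SmoothBoundary Ω)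
    (u : ℝ → R2 → ℝ)
    (hsol : ∀ p > (1:ℝ), IsSolution Ω p (u p))
    (hnod : ∀ p > (1:ℝ), IsNodal Ω (u p))
    (xp xm : ℝ → R2)
    (hxpmem : ∀ p > (1:ℝ), xp p ∈ Ω)
    (hxpmax : ∀ p > (1:ℝ), ∀ x ∈ Ω, u p x ≤ u p (xp p))
    (hxmmem : ∀ p > (1:ℝ), xm p ∈ Ω)
    (hxmmin : ∀ p > (1:ℝ), ∀ x ∈ Ω, u p (xm p) ≤ u p x)
    (hcomp : ∀ p > (1:ℝ), -u p (xm p) ≤ u p (xp p))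
    (hA : CondA Ω u) (hM : MorseOne Ω u) :
    ∃ r > (0:ℝ), ∃ pbar > (1:ℝ), ∀ p ≥ pbar,
      (∃ φ : R2 → ℝ, ContDiff ℝ (⊤ : ℕ∞) φ ∧ HasCompactSupport φ ∧
        tsupport φ ⊆ Metric.ball (0 : R2) r ∧
        (∫ x : R2, ‖gradient φ x‖ ^ 2) <
          ∫ x : R2, |u p (eps u xp p • x + xp p) / u p (xp p)| ^ (p - 1) * φ x ^ 2) ∧
      (∀ ψ : R2 → ℝ, ContDiff ℝ (⊤ : ℕ∞) ψ → HasCompactSupport ψ →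
        tsupport ψ ⊆
          ({x : R2 | eps u xp p • x + xp p ∈ Ω ∧ 0 < u p (eps u xp p • x + xp p)} \ closure (Metric.ball (0 : R2) r)) →
        ψ ≠ 0 →
        (∫ x : R2, |u p (eps u xp p • x + xp p) / u p (xp p)| ^ (p - 1) * ψ x ^ 2) <
          ∫ x : R2, ‖gradient ψ x‖ ^ 2) := by
  obtain ⟨c, hc, hmax⟩ := exists_lower_bound_max hop hbdd
  obtain ⟨κ, hκ, hball⟩ := exists_closedBall_subset hop hbdd hsm
  have hvol : 0 < volume.real (ball (0 : R2) 1) :=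
    ENNReal.toReal_pos (measure_ball_pos _ _ one_pos).ne' measure_ball_lt_top.ne
  obtain ⟨r, hr, φ, hφs, hφc, hφr, hφ1, hφe⟩ :=
    exists_cutoff_small_energy (mul_pos (exp_pos (-(2 * 344))) hvol)
  obtain ⟨P, hP⟩ := eventually_atTop.1 ((eventually_scale_small (r := r) hc hκ).and hM)
  refine ⟨r, by linarith, max P 2, lt_max_of_lt_right one_lt_two, fun p hpP => ?_⟩
  obtain ⟨⟨hs1, hs2, hs3, hs4⟩, -, hMp⟩ := hP p ((le_max_left _ _).trans hpP)
  have hp : 1 < p := one_lt_two.trans_le ((le_max_right _ _).trans hpP)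
  have hp0 : 0 < p := by linarith
  obtain ⟨⟨x₁, hx₁, hux₁⟩, -⟩ := hnod p hp
  set x0 := xp p with hx0
  have hx0Ω : x0 ∈ Ω := hxpmem p hp
  set M := u p x0 with hMdef
  have hM0 : 0 < M := hux₁.trans_le (hxpmax p hp x₁ hx₁)
  have hle : ∀ x ∈ Ω, |u p x| ≤ M := fun x hx =>
    abs_le.2 ⟨by linarith [hxmmin p hp x hx, hcomp p hp], hxpmax p hp x hx⟩
  set K := M ^ (p - 1) with hK
  have hK0 : 0 < K := rpow_pos_of_pos hM0 _
  have hcK : c ≤ K := hmax p M (u p) x0 hp (hsol p hp) hx0Ω hM0 rfl hle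
  set ε := eps u xp p with hε
  have hε0 : 0 < ε := one_div_pos.2 (sqrt_pos.2 (mul_pos hp0 hK0))
  have hε2 : ε ^ 2 = 1 / (p * K) := by
    rw [hε, eps, div_pow, one_pow, sq_sqrt (mul_pos hp0 hK0).le]
  have hεK : ε ^ 2 * K = 1 / p := by rw [hε2]; field_simp
  have hr0 : 0 < r := by linarith
  have hsub : closedBall x0 (6 * (r * ε)) ⊆ Ω := by
    refine hball p M _ (u p) x0 hp (hsol p hp) hx0Ω hM0 rfl hle (by positivity) ?_ ?_
    · refine lt_of_pow_lt_pow_left₀ 2 hκ.le (lt_of_le_of_lt ?_ hs1)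
      calc (6 * (r * ε)) ^ 2 = 36 * r ^ 2 / (p * K) := by rw [mul_pow, mul_pow, hε2]; ring
        _ ≤ 36 * r ^ 2 / (p * c) := by gcongr
    · refine lt_of_eq_of_lt ?_ hs2
      calc (6 * (r * ε)) ^ 2 * K = 36 * r ^ 2 * (ε ^ 2 * K) := by ring
        _ = 36 * r ^ 2 / p := by rw [hεK]; ring
  have hInt : ∀ s, 0 < s → s ≤ r → ∀ x : R2, ‖x‖ ≤ s →
      1 - M⁻¹ * u p (ε • x + x0) ≤ 344 * s ^ 2 / p := by
    intro s hs hsr x hx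
    have h := one_sub_le_of_closedBall_subset hp hop (hsol p hp) hM0 rfl hle (d := s * ε)
      (by positivity) ((closedBall_subset_closedBall (by gcongr)).trans hsub) (y := ε • x + x0)
      (by rw [add_sub_cancel_right, norm_smul, norm_of_nonneg hε0.le, mul_comm]; gcongr)
    calc 1 - M⁻¹ * u p (ε • x + x0) ≤ 344 * (s * ε) ^ 2 * K := h
      _ = 344 * s ^ 2 * (ε ^ 2 * K) := by ring
      _ = 344 * s ^ 2 / p := by rw [hεK]; ring
  set U : Set R2 := {x | ε • x + x0 ∈ Ω ∧ 0 < u p (ε • x + x0)} with hUdef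
  set V : R2 → ℝ := fun x => |u p (ε • x + x0) / M| ^ (p - 1) with hVdef
  have hcA : Continuous fun x : R2 => ε • x + x0 := by fun_prop
  have huΩ : ContinuousOn (u p) Ω := (hsol p hp).1.continuousOn
  have huA : ContinuousOn (fun x => u p (ε • x + x0)) ((fun x : R2 => ε • x + x0) ⁻¹' Ω) :=
    huΩ.comp hcA.continuousOn fun x hx => hx
  have hUo : IsOpen U := huA.isOpen_inter_preimage (hop.preimage hcA) isOpen_Ioi
  have hVU : ContinuousOn V U := by
    refine ContinuousOn.rpow_const ?_ fun x _ => Or.inr (by linarith)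
    exact ((huA.mono fun x hx => hx.1).div_const M).abs
  have hV0 : ∀ x, 0 ≤ V x := fun x => rpow_nonneg (abs_nonneg _) _
  have hV1 : ∀ x ∈ U, |V x| ≤ 1 := fun x hx => by
    rw [abs_of_nonneg (hV0 x)]
    refine rpow_le_one (abs_nonneg _) ?_ (by linarith)
    rw [abs_div, abs_of_pos hM0]
    exact div_le_one_of_le₀ (hle _ hx.1) hM0.le
  have hballU : ball (0 : R2) r ⊆ U := fun x hx => by
    have hx' : ‖x‖ ≤ r := (mem_ball_zero_iff.1 hx).le
    refine ⟨hsub ?_, ?_⟩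
    · rw [mem_closedBall, dist_eq_norm, add_sub_cancel_right, norm_smul, norm_of_nonneg hε0.le]
      nlinarith [mul_le_mul_of_nonneg_left hx' hε0.le, mul_pos hr0 hε0]
    · have h1 := hInt r hr0 le_rfl x hx'
      have h2 : 344 * r ^ 2 / p < 1 := by rwa [div_lt_one hp0]
      exact pos_of_mul_pos_right (a := M⁻¹) (by linarith) (inv_pos.2 hM0).le
  have hφU : CcSmoothIn U φ := ⟨hφs, hφc, hφr.trans hballU⟩
  have hVc : ∀ x ∈ ball (0 : R2) 1, exp (-(2 * 344)) ≤ V x := fun x hx => by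
    have h1 := hInt 1 one_pos hr.le x (mem_ball_zero_iff.1 hx).le
    rw [one_pow, mul_one, inv_mul_eq_div] at h1
    have h2 : u p (ε • x + x0) / M ≤ |u p (ε • x + x0) / M| := le_abs_self _
    exact exp_neg_le_rpow hp (by norm_num) (by linarith) (by linarith)
  have hi : (∫ x, ‖gradient φ x‖ ^ 2) < ∫ x, V x * φ x ^ 2 :=
    hφe.trans_le (mul_volume_ball_le_integral hUo hVU hV0 hφU hφ1 hVc)
  refine ⟨⟨φ, hφs, hφc, hφr, hi⟩, fun ψ hψs hψc hψD hψ0 => ?_⟩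
  have hneg : schrodingerForm V φ < 0 := by
    rw [schrodingerForm_eq_sub hUo hVU hφU]
    linarith
  have hVP : V = fun x => ε ^ 2 * (fun z => p * |u p z| ^ (p - 1)) (x0 + ε • x) := by
    funext x
    simp only [hVdef]
    rw [abs_div, abs_of_pos hM0, div_rpow (abs_nonneg _) hM0.le, add_comm x0, hε2, ← hK]
    field_simp
  have hplane := not_exists_plane_comp_affine (S := {x ∈ Ω | 0 < u p x}) (T := U)
    (P := fun z => p * |u p z| ^ (p - 1)) x0 hε0
    (fun x => by rw [add_comm x0]; rfl) hMp
  rw [← hVP] at hplane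
  have hψ : CcSmoothIn (U \ closure (ball (0 : R2) r)) ψ := ⟨hψs, hψc, hψD⟩
  have hpos := schrodingerForm_pos hUo hVU hV1 (hUo.sdiff isClosed_closure) sdiff_subset hφU hneg
    (disjoint_sdiff_right.mono_left (hφr.trans subset_closure)) hplane hψ hψ0
  rw [schrodingerForm_eq_sub hUo hVU (hψ.mono sdiff_subset)] at hpos
  linarith
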